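/- arXiv:1307.8025 — 2 statements merged into one kernel-verified Lean document; each statement's English description precedes it below -/
import Mathlib

section
/- Let n ≥ 2 and let Ω ⊂ ℝⁿ be a bounded open convex set. Then for every Lipschitz function u : ℝⁿ → ℝ with ∫_Ω u dx = 0 one has ∫_Ω u² dx ≤ (diam(Ω)/π)² ∫_Ω |∇u|² dx, where diam(Ω) is the diameter of Ω. -/
open Real MeasureTheory Set

theorem weighted_dirichlet_poincare {W W₁ W₂ h h₁ : ℝ → ℝ} {a b κ : ℝ}
    (hab : a ≤ b) (hκ : 0 < κ) (hκb : κ * (b - a) < π)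
    (hW : ∀ t, HasDerivAt W (W₁ t) t) (hW₁ : ∀ t, HasDerivAt W₁ (W₂ t) t)
    (hW₂ : Continuous W₂) (hpos : ∀ t, 0 < W t) (hlog : ∀ t, W t * W₂ t ≤ W₁ t ^ 2)
    (hh : ∀ t, HasDerivAt h (h₁ t) t) (hh₁ : Continuous h₁) (ha : h a = 0) (hb : h b = 0) :
    κ ^ 2 * ∫ t in a..b, h t ^ 2 / W t ≤ ∫ t in a..b, h₁ t ^ 2 / W t := by
  have cW : Continuous W := continuous_iff_continuousAt.2 fun t => (hW t).continuousAt
  have cW₁ : Continuous W₁ := continuous_iff_continuousAt.2 fun t => (hW₁ t).continuousAt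
  have ch : Continuous h := continuous_iff_continuousAt.2 fun t => (hh t).continuousAt
  have hne : ∀ t, W t ≠ 0 := fun t => (hpos t).ne'
  set δ := (π - κ * (b - a)) / 2 with hδ
  have hsin : ∀ t ∈ Icc a b, 0 < sin (κ * (t - a) + δ) := by
    intro t ht
    have h1 : 0 ≤ κ * (t - a) := mul_nonneg hκ.le (by linarith [ht.1])
    have h2 : κ * (t - a) ≤ κ * (b - a) := by gcongr; exact ht.2
    apply sin_pos_of_pos_of_lt_pi <;> linarith
  let c : ℝ → ℝ := fun t => cos (κ * (t - a) + δ) / sin (κ * (t - a) + δ)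
  have hc : ∀ t ∈ Icc a b, HasDerivAt c (-κ - κ * c t ^ 2) t := by
    intro t ht
    have hl : HasDerivAt (fun t => κ * (t - a) + δ) κ t := by
      simpa using (((hasDerivAt_id t).sub_const a).const_mul κ).add_const δ
    refine (hl.cos.div hl.sin (hsin t ht).ne').congr_deriv ?_
    have := (hsin t ht).ne'
    simp only [c]
    field_simp
  have cc : ContinuousOn c (Icc a b) := fun t ht => (hc t ht).continuousAt.continuousWithinAt
  let D : ℝ → ℝ := fun t =>
    (-κ ^ 2 - κ ^ 2 * c t ^ 2 + (W₂ t * W t - W₁ t ^ 2) / (2 * W t ^ 2)) * (h t ^ 2 / W t) +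
      (κ * c t + W₁ t / (2 * W t)) * ((2 * h t * h₁ t * W t - h t ^ 2 * W₁ t) / W t ^ 2)
  have hD : ∀ t ∈ Icc a b,
      HasDerivAt (fun t => (κ * c t + W₁ t / (2 * W t)) * (h t ^ 2 / W t)) (D t) t := by
    intro t ht
    have h1 := ((hc t ht).const_mul κ).add ((hW₁ t).div ((hW t).const_mul 2) (by simp [hne t]))
    have h2 := ((hh t).pow 2).div (hW t) (hne t)
    refine (h1.mul h2).congr_deriv ?_
    have := hne t
    simp only [D, Pi.add_apply, Pi.div_apply, Pi.pow_apply]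
    field_simp
    ring
  have cD : ContinuousOn D (Icc a b) := by
    refine ContinuousOn.add (.mul (.add ?_ ?_) ?_) (.mul (.add ?_ ?_) ?_)
    · fun_prop
    · exact Continuous.continuousOn (by fun_prop (disch := intro x; simp [hne x]))
    · exact Continuous.continuousOn (by fun_prop (disch := intro x; simp [hne x]))
    · fun_prop
    · exact Continuous.continuousOn (by fun_prop (disch := intro x; simp [hne x]))
    · exact Continuous.continuousOn (by fun_prop (disch := intro x; simp [hne x]))
  have iD : IntervalIntegrable D volume a b := cD.intervalIntegrable_of_Icc hab
  have hDint : ∫ t in a..b, D t = 0 := by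
    rw [intervalIntegral.integral_eq_sub_of_hasDerivAt (fun t ht => hD t (by rwa [uIcc_of_le hab] at ht)) iD]
    simp [ha, hb]
  have c1 : Continuous fun t => h t ^ 2 / W t := by fun_prop (disch := exact hne)
  have c2 : Continuous fun t => h₁ t ^ 2 / W t := by fun_prop (disch := exact hne)
  have key : ∫ t in a..b, (κ ^ 2 * (h t ^ 2 / W t) + D t) ≤ ∫ t in a..b, h₁ t ^ 2 / W t := by
    refine intervalIntegral.integral_mono_on hab
      (((c1.const_mul _).intervalIntegrable _ _).add iD) (c2.intervalIntegrable _ _) fun t ht => ?_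
    have hw := hpos t
    have : h₁ t ^ 2 / W t - (κ ^ 2 * (h t ^ 2 / W t) + D t) =
        (h₁ t - (κ * c t + W₁ t / (2 * W t)) * h t) ^ 2 / W t +
          ((W₁ t ^ 2 - W t * W₂ t) / (2 * W t ^ 2) + (W₁ t / (2 * W t)) ^ 2) * (h t ^ 2 / W t) := by
      simp only [D]; field_simp; ring
    have h3 : 0 ≤ (W₁ t ^ 2 - W t * W₂ t) := by linarith [hlog t]
    have : 0 ≤ h₁ t ^ 2 / W t - (κ ^ 2 * (h t ^ 2 / W t) + D t) := by rw [this]; positivity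
    linarith
  rw [intervalIntegral.integral_add ((c1.const_mul _).intervalIntegrable _ _) iD, hDint,
    intervalIntegral.integral_const_mul, add_zero] at key
  exact key

theorem weighted_neumann_poincare {W W₁ W₂ g g₁ : ℝ → ℝ} {a b κ : ℝ}
    (hab : a < b) (hκ : 0 < κ) (hκb : κ * (b - a) < π)
    (hW : ∀ t, HasDerivAt W (W₁ t) t) (hW₁ : ∀ t, HasDerivAt W₁ (W₂ t) t)
    (hW₂ : Continuous W₂) (hpos : ∀ t, 0 < W t) (hlog : ∀ t, W t * W₂ t ≤ W₁ t ^ 2)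
    (hg : ∀ t, HasDerivAt g (g₁ t) t) (hg₁ : Continuous g₁) :
    κ ^ 2 * ((∫ t in a..b, W t) * (∫ t in a..b, g t ^ 2 * W t) - (∫ t in a..b, g t * W t) ^ 2) ≤
      (∫ t in a..b, W t) * ∫ t in a..b, g₁ t ^ 2 * W t := by
  have cW : Continuous W := continuous_iff_continuousAt.2 fun t => (hW t).continuousAt
  have cg : Continuous g := continuous_iff_continuousAt.2 fun t => (hg t).continuousAt
  have hne : ∀ t, W t ≠ 0 := fun t => (hpos t).ne'
  have hmass : 0 < ∫ t in a..b, W t :=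
    intervalIntegral.intervalIntegral_pos_of_pos (cW.intervalIntegrable _ _) hpos hab
  set Z := ∫ t in a..b, W t
  set m := (∫ t in a..b, g t * W t) / Z with hm
  let h : ℝ → ℝ := fun t => ∫ s in a..t, (g s - m) * W s
  have cint : Continuous fun s => (g s - m) * W s := by fun_prop
  have hh : ∀ t, HasDerivAt h ((g t - m) * W t) t := fun t =>
    intervalIntegral.integral_hasDerivAt_right (cint.intervalIntegrable _ _)
      (cint.stronglyMeasurableAtFilter _ _) cint.continuousAt
  have ch : Continuous h := continuous_iff_continuousAt.2 fun t => (hh t).continuousAt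
  have ha : h a = 0 := by simp [h]
  have hb : h b = 0 := by
    simp only [h, sub_mul]
    rw [intervalIntegral.integral_sub (Continuous.intervalIntegrable (by fun_prop) _ _)
      (Continuous.intervalIntegrable (by fun_prop) _ _), intervalIntegral.integral_const_mul, hm]
    field_simp
    simp [Z]
  have hD := weighted_dirichlet_poincare hab.le hκ hκb hW hW₁ hW₂ hpos hlog hh cint ha hb
  have e1 : ∫ t in a..b, ((g t - m) * W t) ^ 2 / W t = ∫ t in a..b, (g t - m) ^ 2 * W t := by
    congr 1; ext t; have := hne t; field_simp
  rw [e1] at hD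
  have parts : ∫ t in a..b, (g₁ t * h t + (g t - m) * ((g t - m) * W t)) = 0 := by
    rw [intervalIntegral.integral_eq_sub_of_hasDerivAt (f := fun t => (g t - m) * h t)
      (fun t _ => ((hg t).sub_const m).mul (hh t)) (by
        apply Continuous.intervalIntegrable; fun_prop)]
    simp [ha, hb]
  rw [intervalIntegral.integral_add (Continuous.intervalIntegrable (by fun_prop) _ _)
    (Continuous.intervalIntegrable (by fun_prop) _ _)] at parts
  have e2 : ∫ t in a..b, (g t - m) * ((g t - m) * W t) = ∫ t in a..b, (g t - m) ^ 2 * W t := by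
    congr 1; ext t; ring
  rw [e2] at parts
  have c1 : Continuous fun t => h t ^ 2 / W t := by fun_prop (disch := exact hne)
  have sq : 0 ≤ ∫ t in a..b,
      (g₁ t ^ 2 * W t + 2 * κ ^ 2 * (g₁ t * h t) + κ ^ 4 * (h t ^ 2 / W t)) := by
    refine intervalIntegral.integral_nonneg hab.le fun t _ => ?_
    have hw := hpos t
    have : g₁ t ^ 2 * W t + 2 * κ ^ 2 * (g₁ t * h t) + κ ^ 4 * (h t ^ 2 / W t) =
        (g₁ t * W t + κ ^ 2 * h t) ^ 2 / W t := by field_simp; ring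
    rw [this]; positivity
  rw [intervalIntegral.integral_add (Continuous.intervalIntegrable (by fun_prop) _ _)
      ((c1.const_mul _).intervalIntegrable _ _),
    intervalIntegral.integral_add (Continuous.intervalIntegrable (by fun_prop) _ _)
      (Continuous.intervalIntegrable (by fun_prop) _ _),
    intervalIntegral.integral_const_mul, intervalIntegral.integral_const_mul] at sq
  have e3 : ∫ t in a..b, (g t - m) ^ 2 * W t =
      (∫ t in a..b, g t ^ 2 * W t) - (∫ t in a..b, g t * W t) ^ 2 / Z := by
    have : ∀ t, (g t - m) ^ 2 * W t = g t ^ 2 * W t - 2 * m * (g t * W t) + m ^ 2 * W t := by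
      intro t; ring
    simp only [this]
    rw [intervalIntegral.integral_add (Continuous.intervalIntegrable (by fun_prop) _ _)
      (Continuous.intervalIntegrable (by fun_prop) _ _),
      intervalIntegral.integral_sub (Continuous.intervalIntegrable (by fun_prop) _ _)
      (Continuous.intervalIntegrable (by fun_prop) _ _),
      intervalIntegral.integral_const_mul, intervalIntegral.integral_const_mul, hm]
    change _ + _ * Z = _
    field_simp
    ring
  have fin : κ ^ 2 * (∫ t in a..b, (g t - m) ^ 2 * W t) ≤ ∫ t in a..b, g₁ t ^ 2 * W t := by
    nlinarith [mul_le_mul_of_nonneg_left hD (sq_nonneg κ)]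
  rw [e3] at fin
  calc _ = Z * (κ ^ 2 * ((∫ t in a..b, g t ^ 2 * W t) - (∫ t in a..b, g t * W t) ^ 2 / Z)) := by
        field_simp
    _ ≤ _ := mul_le_mul_of_nonneg_left fin hmass.le

open scoped ENNReal Pointwise

theorem Real.volume_add_volume_le_volume_add {A B : Set ℝ} (hA : A.Nonempty) (hB : B.Nonempty)
    (mA : MeasurableSet A) (mB : MeasurableSet B) :
    volume A + volume B ≤ volume (A + B) := by
  have compact_case : ∀ K ⊆ A, ∀ L ⊆ B, IsCompact K → IsCompact L →
      volume K + volume L ≤ volume (A + B) := by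
    intro K hK L hL cK cL
    rcases K.eq_empty_or_nonempty with rfl | nK
    · obtain ⟨x, hx⟩ := hA
      calc _ = volume ({x} + L) := by simp [singleton_add]
        _ ≤ _ := measure_mono (add_subset_add (by simpa) hL)
    rcases L.eq_empty_or_nonempty with rfl | nL
    · obtain ⟨x, hx⟩ := hB
      calc _ = volume (K + {x}) := by simp
        _ ≤ _ := measure_mono (add_subset_add hK (by simpa))
    obtain ⟨k, hk, hkmax⟩ := cK.exists_isGreatest nK
    obtain ⟨l, hl, hlmin⟩ := cL.exists_isLeast nL
    have hd : AEDisjoint volume (K + {l}) ({k} + L) := by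
      refine measure_mono_null (t := {k + l}) ?_ (by simp)
      rintro x ⟨h1, h2⟩
      simp only [add_singleton, singleton_add, mem_image] at h1 h2
      obtain ⟨y, hy, rfl⟩ := h1
      obtain ⟨z, hz, h⟩ := h2
      have := hkmax hy
      have := hlmin hz
      simp only [mem_singleton_iff]
      linarith
    have mL : NullMeasurableSet ({k} + L) volume :=
      (isCompact_singleton.add cL).measurableSet.nullMeasurableSet
    calc volume K + volume L = volume (K + {l}) + volume ({k} + L) := by simp
      _ = volume ((K + {l}) ∪ ({k} + L)) := (measure_union₀ mL hd).symm
      _ ≤ volume (A + B) := measure_mono (union_subset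
          (add_subset_add hK (by simpa using hL hl)) (add_subset_add (by simpa using hK hk) hL))
  rw [mA.measure_eq_iSup_isCompact, mB.measure_eq_iSup_isCompact]
  simp only [iSup_and']
  exact ENNReal.biSup_add_biSup_le' ⟨∅, by simp⟩ ⟨∅, by simp⟩ fun K hK L hL =>
    compact_case K hK.1 L hL.1 hK.2 hL.2

theorem ENNReal.four_mul_le_add_sq (a b : ℝ≥0∞) : 4 * (a * b) ≤ (a + b) ^ 2 := by
  wlog hab : a ≤ b generalizing a b
  · rw [mul_comm a, add_comm a]; exact this b a (le_of_not_ge hab)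
  obtain ⟨c, rfl⟩ := le_iff_exists_add.1 hab
  calc 4 * (a * (a + c)) ≤ 4 * (a * (a + c)) + c ^ 2 := le_self_add
    _ = _ := by ring

theorem lintegral_eq_lintegral_Ioo_meas_lt {f : ℝ → ℝ≥0∞} (mf : Measurable f)
    (hf : ∀ x, f x ≤ 1) :
    ∫⁻ x, f x = ∫⁻ t in Ioo (0 : ℝ) 1, volume {x | ENNReal.ofReal t < f x} := by
  have hfin : ∀ x, f x ≠ ∞ := fun x => ((hf x).trans_lt ENNReal.one_lt_top).ne
  have e : ∀ x, f x = ENNReal.ofReal (f x).toReal := fun x => (ENNReal.ofReal_toReal (hfin x)).symm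
  calc ∫⁻ x, f x = ∫⁻ x, ENNReal.ofReal (f x).toReal := lintegral_congr e
    _ = ∫⁻ t in Ioi (0 : ℝ), volume {x | t < (f x).toReal} :=
      lintegral_eq_lintegral_meas_lt _ (ae_of_all _ fun x => ENNReal.toReal_nonneg)
        mf.ennreal_toReal.aemeasurable
    _ = ∫⁻ t in Ioi (0 : ℝ), (Ioo (0 : ℝ) 1).indicator
          (fun t => volume {x | ENNReal.ofReal t < f x}) t := by
      refine setLIntegral_congr_fun measurableSet_Ioi fun t ht => ?_
      have hset : {x | t < (f x).toReal} = {x | ENNReal.ofReal t < f x} := by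
        ext x
        exact (ENNReal.ofReal_lt_iff_lt_toReal (le_of_lt ht) (hfin x)).symm
      by_cases h1 : t < 1
      · rw [indicator_of_mem (show t ∈ Ioo (0 : ℝ) 1 from ⟨ht, h1⟩), hset]
      · rw [indicator_of_notMem (fun h => h1 h.2)]
        convert measure_empty (μ := volume)
        ext x
        simp only [mem_ofPred_eq, mem_empty_iff_false, iff_false, not_lt]
        exact (ENNReal.toReal_mono ENNReal.one_ne_top (hf x)).trans (by simpa using h1)
    _ = _ := by
      rw [setLIntegral_indicator measurableSet_Ioo, inter_eq_left.2 Ioo_subset_Ioi_self]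

/-- The Prékopa–Leindler inequality on the line, for functions with supremum one. -/
theorem prekopaLeindler_real_of_sup_eq_one {f g h : ℝ → ℝ≥0∞} (mf : Measurable f)
    (mg : Measurable g) (mh : Measurable h) (hf : ⨆ x, f x = 1) (hg : ⨆ x, g x = 1)
    (hfg : ∀ x y, f x * g y ≤ h ((x + y) / 2) ^ 2) :
    (∫⁻ x, f x) + ∫⁻ x, g x ≤ 2 * ∫⁻ x, h x := by
  have f1 : ∀ x, f x ≤ 1 := fun x => hf ▸ le_iSup f x
  have g1 : ∀ x, g x ≤ 1 := fun x => hg ▸ le_iSup g x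
  have mk : Measurable fun x => min (h x) 1 := mh.min measurable_const
  have hfg' : ∀ x y, f x * g y ≤ (min (h ((x + y) / 2)) 1) ^ 2 := by
    intro x y
    rcases le_total (h ((x + y) / 2)) 1 with h1 | h1
    · rw [min_eq_left h1]; exact hfg x y
    · rw [min_eq_right h1, one_pow]; exact mul_le_one' (f1 x) (g1 y)
  calc (∫⁻ x, f x) + ∫⁻ x, g x
      = ∫⁻ t in Ioo (0 : ℝ) 1, (volume {x | ENNReal.ofReal t < f x} +
          volume {x | ENNReal.ofReal t < g x}) := by
        rw [lintegral_eq_lintegral_Ioo_meas_lt mf f1, lintegral_eq_lintegral_Ioo_meas_lt mg g1,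
          lintegral_add_left]
        exact Antitone.measurable fun s t hst => measure_mono fun x hx =>
          (ENNReal.ofReal_le_ofReal hst).trans_lt hx
    _ ≤ ∫⁻ t in Ioo (0 : ℝ) 1, 2 * volume {x | ENNReal.ofReal t < min (h x) 1} := by
        refine setLIntegral_mono' measurableSet_Ioo fun t ht => ?_
        have ht1 : ENNReal.ofReal t < 1 := by simpa using ht.2
        have nf : {x | ENNReal.ofReal t < f x}.Nonempty := by
          rw [← hf] at ht1
          obtain ⟨x, hx⟩ := lt_iSup_iff.1 ht1
          exact ⟨x, hx⟩
        have ng : {x | ENNReal.ofReal t < g x}.Nonempty := by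
          rw [← hg] at ht1
          obtain ⟨x, hx⟩ := lt_iSup_iff.1 ht1
          exact ⟨x, hx⟩
        refine (Real.volume_add_volume_le_volume_add nf ng (measurableSet_lt measurable_const mf)
          (measurableSet_lt measurable_const mg)).trans ?_
        have : (2 : ℝ≥0∞) * volume {x | ENNReal.ofReal t < min (h x) 1} =
            volume ((2 : ℝ) • {x | ENNReal.ofReal t < min (h x) 1}) := by
          rw [Measure.addHaar_smul]; simp
        rw [this]
        refine measure_mono ?_
        rintro _ ⟨x, hx, y, hy, rfl⟩
        refine ⟨(x + y) / 2, ?_, by simp only [smul_eq_mul]; ring⟩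
        have := (ENNReal.mul_lt_mul hx hy).trans_le (hfg' x y)
        rw [← sq] at this
        exact lt_of_not_ge fun hle => this.not_ge (pow_le_pow_left' hle 2)
    _ = 2 * ∫⁻ x, min (h x) 1 := by
        rw [lintegral_eq_lintegral_Ioo_meas_lt mk fun x => min_le_right _ _,
          lintegral_const_mul' _ _ (by simp)]
    _ ≤ 2 * ∫⁻ x, h x := by gcongr; exact min_le_left _ _

/-- The Prékopa–Leindler inequality on the line, for midpoints. -/
theorem prekopaLeindler_real {f g h : ℝ → ℝ≥0∞} (mf : Measurable f)
    (mg : Measurable g) (mh : Measurable h) (hfg : ∀ x y, f x * g y ≤ h ((x + y) / 2) ^ 2) :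
    (∫⁻ x, f x) * ∫⁻ x, g x ≤ (∫⁻ x, h x) ^ 2 := by
  have bounded : ∀ f g : ℝ → ℝ≥0∞, Measurable f → Measurable g → ⨆ x, f x ≠ ∞ → ⨆ x, g x ≠ ∞ →
      (∀ x y, f x * g y ≤ h ((x + y) / 2) ^ 2) → (∫⁻ x, f x) * ∫⁻ x, g x ≤ (∫⁻ x, h x) ^ 2 := by
    intro f g mf mg hM hN hfg
    set M := ⨆ x, f x with M_def
    set N := ⨆ x, g x with N_def
    rcases eq_or_ne M 0 with hM0 | hM0
    · have : ∀ x, f x = 0 := fun x => le_zero_iff.1 (hM0 ▸ le_iSup f x)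
      simp [this]
    rcases eq_or_ne N 0 with hN0 | hN0
    · have : ∀ x, g x = 0 := fun x => le_zero_iff.1 (hN0 ▸ le_iSup g x)
      simp [this]
    set C : ℝ≥0∞ := (M * N) ^ (1 / 2 : ℝ) with C_def
    have hMN : M * N ≠ ∞ := ENNReal.mul_ne_top hM hN
    have hC2 : C ^ 2 = M * N := by
      rw [C_def, ← ENNReal.rpow_natCast, ← ENNReal.rpow_mul]; norm_num
    have hC2' : (C⁻¹) ^ 2 = M⁻¹ * N⁻¹ := by
      rw [← ENNReal.inv_pow, hC2, ENNReal.mul_inv (Or.inl hM0) (Or.inl hM)]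
    have key := prekopaLeindler_real_of_sup_eq_one (mf.const_mul M⁻¹) (mg.const_mul N⁻¹)
      (mh.const_mul C⁻¹)
      (by rw [← ENNReal.mul_iSup, ← M_def, ENNReal.inv_mul_cancel hM0 hM])
      (by rw [← ENNReal.mul_iSup, ← N_def, ENNReal.inv_mul_cancel hN0 hN])
      (fun x y => by
        rw [mul_pow, hC2', mul_mul_mul_comm]; gcongr; exact hfg x y)
    rw [lintegral_const_mul _ mf, lintegral_const_mul _ mg, lintegral_const_mul _ mh] at key
    have h4 := (ENNReal.four_mul_le_add_sq _ _).trans (pow_le_pow_left' key 2)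
    rw [mul_pow, mul_pow, hC2', mul_mul_mul_comm, ← hC2'] at h4
    norm_num at h4
    rw [ENNReal.mul_le_mul_iff_right (by norm_num) (by norm_num)] at h4
    rwa [ENNReal.mul_le_mul_iff_right] at h4
    · rw [hC2']; simp [hM, hN]
    · rw [hC2']; exact ENNReal.mul_ne_top (by simpa) (by simpa)
  have trunc : ∀ {f : ℝ → ℝ≥0∞}, Measurable f → ∫⁻ x, f x = ⨆ k : ℕ, ∫⁻ x, min (f x) k := by
    intro f mf
    rw [← lintegral_iSup (fun k => mf.min measurable_const)
      (fun i j hij x => min_le_min le_rfl (by exact_mod_cast hij))]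
    refine lintegral_congr fun x => ?_
    rw [← inf_iSup_eq, ENNReal.iSup_natCast, inf_top_eq]
  rw [trunc mf, trunc mg, ENNReal.iSup_mul]
  refine iSup_le fun j => ?_
  rw [ENNReal.mul_iSup]
  refine iSup_le fun k => ?_
  have fin : ∀ (f : ℝ → ℝ≥0∞) (k : ℕ), ⨆ x, min (f x) k ≠ ∞ := fun f k =>
    ((iSup_le fun x => min_le_right _ _).trans_lt (ENNReal.natCast_lt_top k)).ne
  exact bounded _ _ (mf.min measurable_const) (mg.min measurable_const) (fin f j) (fin g k)
    fun x y => (mul_le_mul' (min_le_left _ _) (min_le_left _ _)).trans (hfg x y)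

/-- The Prékopa–Leindler inequality on `ℝⁿ`, for midpoints. -/
theorem prekopaLeindler_pi : ∀ {n : ℕ} {f g h : (Fin n → ℝ) → ℝ≥0∞}, Measurable f →
    Measurable g → Measurable h → (∀ x y, f x * g y ≤ h ((2 : ℝ)⁻¹ • (x + y)) ^ 2) →
    (∫⁻ x, f x) * ∫⁻ x, g x ≤ (∫⁻ x, h x) ^ 2
  | 0, f, g, h, _, _, _, hfg => by
    have (k : (Fin 0 → ℝ) → ℝ≥0∞) : ∫⁻ x, k x = k 0 := by
      rw [Measure.volume_pi_eq_dirac 0, lintegral_dirac]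
    simpa [this] using hfg 0 0
  | n + 1, f, g, h, mf, mg, mh, hfg => by
    let e := MeasurableEquiv.piFinSuccAbove (fun _ : Fin (n + 1) => ℝ) 0
    have he : MeasurePreserving e.symm volume volume :=
      (volume_preserving_piFinSuccAbove (fun _ : Fin (n + 1) => ℝ) 0).symm
    have split {k : (Fin (n + 1) → ℝ) → ℝ≥0∞} (mk : Measurable k) :
        ∫⁻ x, k x = ∫⁻ t : ℝ, ∫⁻ y : Fin n → ℝ, k (e.symm (t, y)) := by
      rw [← he.lintegral_comp mk]
      exact lintegral_prod _ (mk.comp e.symm.measurable).aemeasurable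
    have slice {k : (Fin (n + 1) → ℝ) → ℝ≥0∞} (mk : Measurable k) :
        Measurable fun t : ℝ => ∫⁻ y : Fin n → ℝ, k (e.symm (t, y)) :=
      (mk.comp e.symm.measurable).lintegral_prod_right'
    rw [split mf, split mg, split mh]
    refine prekopaLeindler_real (slice mf) (slice mg) (slice mh) fun s t => ?_
    refine prekopaLeindler_pi (mf.comp (e.symm.measurable.comp measurable_prodMk_left))
      (mg.comp (e.symm.measurable.comp measurable_prodMk_left))
      (mh.comp (e.symm.measurable.comp measurable_prodMk_left)) fun x y => ?_
    convert hfg (e.symm (s, x)) (e.symm (t, y)) using 3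
    ext i
    refine Fin.cases ?_ (fun i => ?_) i
    · simp [e, MeasurableEquiv.piFinSuccAbove]; ring
    · simp [e, MeasurableEquiv.piFinSuccAbove]; ring

/-- The Prékopa–Leindler inequality on Euclidean space, for midpoints. -/
theorem prekopaLeindler {n : ℕ} {f g h : EuclideanSpace ℝ (Fin n) → ℝ≥0∞} (mf : Measurable f)
    (mg : Measurable g) (mh : Measurable h)
    (hfg : ∀ x y, f x * g y ≤ h ((2 : ℝ)⁻¹ • (x + y)) ^ 2) :
    (∫⁻ x, f x) * ∫⁻ x, g x ≤ (∫⁻ x, h x) ^ 2 := by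
  have he := PiLp.volume_preserving_toLp (Fin n)
  rw [← he.lintegral_comp mf, ← he.lintegral_comp mg, ← he.lintegral_comp mh]
  exact prekopaLeindler_pi (mf.comp he.measurable) (mg.comp he.measurable)
    (mh.comp he.measurable) fun x y => hfg _ _

open Filter Topology

/-- The scaled Gaussian `s ↦ c exp (-π (c s)²)`, of total mass one. -/
noncomputable def gaussKernel (c s : ℝ) : ℝ := c * exp (-π * (c * s) ^ 2)

theorem continuous_gaussKernel (c : ℝ) : Continuous (gaussKernel c) := by
  unfold gaussKernel; fun_prop

theorem gaussKernel_pos {c : ℝ} (hc : 0 < c) (s : ℝ) : 0 < gaussKernel c s :=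
  mul_pos hc (exp_pos _)

theorem gaussKernel_le {c : ℝ} (hc : 0 < c) (s : ℝ) : gaussKernel c s ≤ c := by
  refine mul_le_of_le_one_right hc.le (exp_le_one_iff.2 ?_)
  have := pi_pos
  nlinarith [mul_nonneg pi_pos.le (sq_nonneg (c * s))]

theorem integral_gaussKernel {c : ℝ} (hc : 0 < c) : ∫ s, gaussKernel c s = 1 := by
  unfold gaussKernel
  rw [integral_const_mul, Measure.integral_comp_mul_left (fun s => exp (-π * s ^ 2)),
    integral_gaussian]
  simp [abs_of_pos hc, hc.ne', pi_ne_zero]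

theorem integrable_gaussKernel {c : ℝ} (hc : 0 < c) : Integrable (gaussKernel c) :=
  integrable_of_integral_eq_one (integral_gaussKernel hc)

theorem tendsto_integral_mul_gaussKernel {k : ℝ → ℝ} (hk : Continuous k) {a b y : ℝ}
    (hy : y ∈ Ioo a b) :
    Tendsto (fun c => ∫ t in a..b, k t * gaussKernel c (t - y)) atTop (𝓝 (k y)) := by
  have hab : a ≤ b := (hy.1.trans hy.2).le
  have h1 : Integrable ((Ioc a b).indicator k) :=
    (hk.integrableOn_Ioc).integrable_indicator measurableSet_Ioc
  have h2 : ContinuousAt ((Ioc a b).indicator k) y := by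
    refine hk.continuousAt.congr ?_
    filter_upwards [Ioo_mem_nhds hy.1 hy.2] with t ht
    rw [indicator_of_mem (Ioo_subset_Ioc_self ht)]
  have h3 : Tendsto (fun x : ℝ => ‖x‖ ^ Module.finrank ℝ ℝ * exp (-π * x ^ 2))
      (Bornology.cobounded ℝ) (𝓝 0) := by
    simpa [Metric.cobounded_eq_cocompact] using
      tendsto_rpow_abs_mul_exp_neg_mul_sq_cocompact pi_pos 1
  have h4 : ∫ x : ℝ, exp (-π * x ^ 2) = 1 := by
    rw [integral_gaussian]; simp [pi_ne_zero]
  have := tendsto_integral_comp_smul_smul_of_integrable' (μ := volume)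
    (φ := fun x : ℝ => exp (-π * x ^ 2)) (fun x => (exp_pos _).le) h4 h3 h1 h2
  rw [indicator_of_mem (Ioo_subset_Ioc_self hy)] at this
  refine this.congr fun c => ?_
  rw [intervalIntegral.integral_of_le hab, ← integral_indicator measurableSet_Ioc]
  congr 1
  ext t
  by_cases ht : t ∈ Ioc a b
  · simp only [indicator_of_mem ht, Module.finrank_self, pow_one, smul_eq_mul, gaussKernel]
    ring_nf
  · simp [indicator_of_notMem ht]

section Marginal

variable {α : Type*} [MeasurableSpace α] {ν : Measure α} [IsFiniteMeasure ν] {ℓ : α → ℝ}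
  {a b : ℝ}

theorem tendsto_integral_mul_gaussian_marginal (hℓ : Measurable ℓ) (hab : a ≤ b)
    (hℓab : ∀ᵐ x ∂ν, ℓ x ∈ Ioo a b) {k : ℝ → ℝ} (hk : Continuous k) :
    Tendsto (fun c => ∫ t in a..b, k t * ∫ x, gaussKernel c (t - ℓ x) ∂ν) atTop
      (𝓝 (∫ x, k (ℓ x) ∂ν)) := by
  obtain ⟨M, hM⟩ := isCompact_Icc.exists_bound_of_continuousOn (s := Icc a b) hk.continuousOn
  have swap : ∀ᶠ c in atTop, ∫ x, (∫ t in a..b, k t * gaussKernel c (t - ℓ x)) ∂ν =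
      ∫ t in a..b, k t * ∫ x, gaussKernel c (t - ℓ x) ∂ν := by
    filter_upwards [eventually_gt_atTop 0] with c hc
    rw [← intervalIntegral_integral_swap]
    · simp only [integral_const_mul]
    · have h1 : Integrable (fun z : ℝ × α => k z.1 * 1) ((volume.restrict (uIoc a b)).prod ν) := by
        refine Integrable.mul_prod ?_ (integrable_const (1 : ℝ))
        exact hk.integrableOn_uIoc
      have h2 := h1.mul_bdd (c := c) (g := fun z : ℝ × α => gaussKernel c (z.1 - ℓ z.2))
        ((continuous_gaussKernel c).measurable.comp
          (measurable_fst.sub (hℓ.comp measurable_snd))).aestronglyMeasurable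
        (ae_of_all _ fun z => by
          rw [norm_of_nonneg (gaussKernel_pos hc _).le]; exact gaussKernel_le hc _)
      simp only [mul_one] at h2
      exact h2
  refine Tendsto.congr' swap (tendsto_integral_filter_of_dominated_convergence (fun _ => M)
    ?_ ?_ (integrable_const M) ?_)
  · refine Eventually.of_forall fun c => ?_
    have : Continuous fun y => ∫ t in a..b, k t * gaussKernel c (t - y) := by
      apply intervalIntegral.continuous_parametric_intervalIntegral_of_continuous'
      have := continuous_gaussKernel c
      fun_prop
    exact (this.measurable.comp hℓ).aestronglyMeasurable
  · filter_upwards [eventually_gt_atTop 0] with c hc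
    refine ae_of_all _ fun x => ?_
    have hM0 : 0 ≤ M := (norm_nonneg _).trans (hM a (left_mem_Icc.2 hab))
    have hi : Integrable fun t => gaussKernel c (t - ℓ x) :=
      (integrable_gaussKernel hc).comp_sub_right _
    calc ‖∫ t in a..b, k t * gaussKernel c (t - ℓ x)‖
        ≤ ∫ t in a..b, M * gaussKernel c (t - ℓ x) := by
          refine intervalIntegral.norm_integral_le_of_norm_le hab (ae_of_all _ fun t ht => ?_)
            (hi.const_mul M).intervalIntegrable
          rw [norm_mul, norm_of_nonneg (gaussKernel_pos hc _).le]
          exact mul_le_mul_of_nonneg_right (hM t (Ioc_subset_Icc_self ht))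
            (gaussKernel_pos hc _).le
      _ = M * ∫ t in Ioc a b, gaussKernel c (t - ℓ x) := by
          rw [intervalIntegral.integral_const_mul, intervalIntegral.integral_of_le hab]
      _ ≤ M * ∫ t, gaussKernel c (t - ℓ x) := by
          refine mul_le_mul_of_nonneg_left (setIntegral_le_integral hi
            (ae_of_all _ fun t => (gaussKernel_pos hc _).le)) hM0
      _ = M := by rw [integral_sub_right_eq_self, integral_gaussKernel hc, mul_one]
  · filter_upwards [hℓab] with x hx
    exact tendsto_integral_mul_gaussKernel hk hx

theorem hasDerivAt_integral_comp_sub (hℓ : Measurable ℓ)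
    (hℓab : ∀ᵐ x ∂ν, ℓ x ∈ Ioo a b) {K K' : ℝ → ℝ} (hK : ∀ t, HasDerivAt K (K' t) t)
    (hK' : Continuous K') (t : ℝ) :
    HasDerivAt (fun t => ∫ x, K (t - ℓ x) ∂ν) (∫ x, K' (t - ℓ x) ∂ν) t := by
  have cK : Continuous K := continuous_iff_continuousAt.2 fun t => (hK t).continuousAt
  obtain ⟨M, hM⟩ := isCompact_Icc.exists_bound_of_continuousOn
    (s := Icc (t - 1 - b) (t + 1 - a)) hK'.continuousOn
  obtain ⟨M₀, hM₀⟩ := isCompact_Icc.exists_bound_of_continuousOn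
    (s := Icc (t - 1 - b) (t + 1 - a)) cK.continuousOn
  have mem : ∀ᵐ x ∂ν, ∀ s ∈ Ioo (t - 1) (t + 1), s - ℓ x ∈ Icc (t - 1 - b) (t + 1 - a) := by
    filter_upwards [hℓab] with x hx s hs
    exact ⟨by linarith [hx.2, hs.1], by linarith [hx.1, hs.2]⟩
  have hs : Ioo (t - 1) (t + 1) ∈ 𝓝 t := Ioo_mem_nhds (by linarith) (by linarith)
  refine (hasDerivAt_integral_of_dominated_loc_of_deriv_le (bound := fun _ => M)
    (F := fun s x => K (s - ℓ x)) (F' := fun s x => K' (s - ℓ x)) hs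
    (Eventually.of_forall fun s => (cK.measurable.comp
      (measurable_const.sub hℓ)).aestronglyMeasurable) ?_
    (hK'.measurable.comp (measurable_const.sub hℓ)).aestronglyMeasurable ?_
    (integrable_const M) (ae_of_all _ fun x s _ => ?_)).2
  · refine Integrable.of_bound
      (cK.measurable.comp (measurable_const.sub hℓ)).aestronglyMeasurable M₀ ?_
    filter_upwards [mem] with x hx using hM₀ _ (hx t (mem_of_mem_nhds hs))
  · filter_upwards [mem] with x hx s hs using hM _ (hx s hs)
  · exact (hK (s - ℓ x)).comp_sub_const s (ℓ x)

end Marginal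

theorem mul_deriv2_le_sq_deriv {W W₁ W₂ : ℝ → ℝ} (hW : ∀ t, HasDerivAt W (W₁ t) t)
    (hW₁ : ∀ t, HasDerivAt W₁ (W₂ t) t) (hmid : ∀ s t, W s * W t ≤ W ((s + t) / 2) ^ 2) (t : ℝ) :
    W t * W₂ t ≤ W₁ t ^ 2 := by
  have p (r : ℝ) : HasDerivAt (fun r => t + r) 1 r := by simpa using (hasDerivAt_id r).const_add t
  have q (r : ℝ) : HasDerivAt (fun r => t - r) (-1) r := by
    simpa using (hasDerivAt_id r).const_sub t
  let R : ℝ → ℝ := fun r => W (t + r) * W (t - r)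
  let R₁ : ℝ → ℝ := fun r => W₁ (t + r) * W (t - r) - W (t + r) * W₁ (t - r)
  have hR : ∀ r, HasDerivAt R (R₁ r) r := fun r =>
    (((hW _).comp r (p r)).mul ((hW _).comp r (q r))).congr_deriv (by simp [R₁]; ring)
  have hR₁ : HasDerivAt R₁ (2 * (W t * W₂ t - W₁ t ^ 2)) 0 :=
    ((((hW₁ _).comp 0 (p 0)).mul ((hW _).comp 0 (q 0))).sub
      (((hW _).comp 0 (p 0)).mul ((hW₁ _).comp 0 (q 0)))).congr_deriv (by simp; ring)
  have dR : deriv R = R₁ := funext fun r => (hR r).deriv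
  by_contra! hlt
  have hmin : IsLocalMin R 0 := by
    refine isLocalMin_of_deriv_deriv_pos ?_ ?_ (hR 0).continuousAt
    · rw [dR, hR₁.deriv]; linarith
    · rw [dR]; simp [R₁]; ring
  have hconst : R =ᶠ[𝓝 0] fun _ => R 0 := by
    filter_upwards [hmin] with r hr
    refine le_antisymm ?_ hr
    have := hmid (t + r) (t - r)
    simp only [R, add_zero, sub_zero]
    calc _ ≤ _ := this
      _ = _ := by ring_nf
  have h0 : R₁ =ᶠ[𝓝 0] fun _ => 0 := by
    have := hconst.deriv
    rw [dR] at this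
    simpa using this
  have := h0.deriv_eq
  rw [hR₁.deriv] at this
  simp at this
  linarith

theorem hasDerivAt_gaussKernel (c s : ℝ) :
    HasDerivAt (gaussKernel c) (-(2 * π * c ^ 2) * (s * gaussKernel c s)) s := by
  have h : HasDerivAt (fun s : ℝ => -π * (c * s) ^ 2) (-(2 * π * c ^ 2 * s)) s :=
    ((((hasDerivAt_id s).const_mul c).pow 2).const_mul (-π)).congr_deriv (by simp; ring)
  exact (h.exp.const_mul c).congr_deriv (by unfold gaussKernel; ring)

theorem gaussKernel_mul_le (c : ℝ) (p q : ℝ) :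
    gaussKernel c p * gaussKernel c q ≤ gaussKernel c ((p + q) / 2) ^ 2 := by
  have h : exp (-π * (c * p) ^ 2) * exp (-π * (c * q) ^ 2) ≤
      exp (-π * (c * ((p + q) / 2)) ^ 2) ^ 2 := by
    rw [← exp_add, ← exp_nat_mul]
    refine exp_le_exp.2 ?_
    push_cast
    nlinarith [mul_nonneg pi_pos.le (sq_nonneg (c * (p - q)))]
  unfold gaussKernel
  nlinarith [mul_le_mul_of_nonneg_left h (sq_nonneg c)]

section Needle

variable {n : ℕ} {A : Set (EuclideanSpace ℝ (Fin n))} {ℓ : EuclideanSpace ℝ (Fin n) →L[ℝ] ℝ}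

theorem gaussian_marginal_mul_le (hA : MeasurableSet A) (hconv : Convex ℝ A)
    (hfin : volume A ≠ ⊤) {c : ℝ} (hc : 0 < c) (s t : ℝ) :
    (∫ x in A, gaussKernel c (s - ℓ x)) * (∫ x in A, gaussKernel c (t - ℓ x)) ≤
      (∫ x in A, gaussKernel c ((s + t) / 2 - ℓ x)) ^ 2 := by
  have : IsFiniteMeasure (volume.restrict A) := ⟨by simpa using hfin.lt_top⟩
  have cont (r : ℝ) : Continuous fun x => gaussKernel c (r - ℓ x) :=
    (continuous_gaussKernel c).comp (by fun_prop)
  have int (r : ℝ) : IntegrableOn (fun x => gaussKernel c (r - ℓ x)) A :=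
    Integrable.of_bound (cont r).aestronglyMeasurable c (ae_of_all _ fun x => by
      rw [norm_of_nonneg (gaussKernel_pos hc _).le]; exact gaussKernel_le hc _)
  let F (r : ℝ) : EuclideanSpace ℝ (Fin n) → ENNReal :=
    A.indicator fun x => ENNReal.ofReal (gaussKernel c (r - ℓ x))
  have mF (r : ℝ) : Measurable (F r) := (cont r).measurable.ennreal_ofReal.indicator hA
  have eF (r : ℝ) : ∫⁻ x, F r x = ENNReal.ofReal (∫ x in A, gaussKernel c (r - ℓ x)) := by
    rw [lintegral_indicator hA,
      ofReal_integral_eq_lintegral_ofReal (int r) (ae_of_all _ fun x => (gaussKernel_pos hc _).le)]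
  have hnn (r : ℝ) : 0 ≤ ∫ x in A, gaussKernel c (r - ℓ x) :=
    integral_nonneg fun x => (gaussKernel_pos hc _).le
  have := prekopaLeindler (mF s) (mF t) (mF ((s + t) / 2)) fun x y => by
    by_cases hx : x ∈ A
    · by_cases hy : y ∈ A
      · have hxy : (2 : ℝ)⁻¹ • (x + y) ∈ A := by
          rw [smul_add]
          exact hconv hx hy (by norm_num) (by norm_num) (by norm_num)
        simp only [F, indicator_of_mem hx, indicator_of_mem hy, indicator_of_mem hxy]
        rw [← ENNReal.ofReal_mul (gaussKernel_pos hc _).le,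
          ← ENNReal.ofReal_pow (gaussKernel_pos hc _).le]
        refine ENNReal.ofReal_le_ofReal ((gaussKernel_mul_le c _ _).trans_eq ?_)
        congr 2
        simp only [map_smul, map_add, smul_eq_mul]
        ring
      · simp [F, indicator_of_notMem hy]
    · simp [F, indicator_of_notMem hx]
  rw [eF, eF, eF, ← ENNReal.ofReal_mul (hnn s), ← ENNReal.ofReal_pow (hnn _)] at this
  exact (ENNReal.ofReal_le_ofReal_iff (by positivity)).1 this

theorem needle_poincare (hA : MeasurableSet A) (hconv : Convex ℝ A) (hfin : volume A ≠ ⊤)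
    {a b κ : ℝ} (hab : a < b) (hκ : 0 < κ) (hκb : κ * (b - a) < π)
    (hℓ : ∀ x ∈ A, ℓ x ∈ Ioo a b) {g g₁ : ℝ → ℝ} (hg : ∀ t, HasDerivAt g (g₁ t) t)
    (hg₁ : Continuous g₁) :
    κ ^ 2 * (volume.real A * (∫ x in A, g (ℓ x) ^ 2) - (∫ x in A, g (ℓ x)) ^ 2) ≤
      volume.real A * ∫ x in A, g₁ (ℓ x) ^ 2 := by
  rcases eq_or_ne (volume A) 0 with h0 | h0
  · simp [Measure.restrict_eq_zero.2 h0]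
  have : IsFiniteMeasure (volume.restrict A) := ⟨by simpa using hfin.lt_top⟩
  have : NeZero (volume.restrict A) := ⟨by simpa using h0⟩
  have mℓ : Measurable ℓ := ℓ.continuous.measurable
  have aeℓ : ∀ᵐ x ∂volume.restrict A, ℓ x ∈ Ioo a b :=
    (ae_restrict_iff' hA).2 (ae_of_all _ hℓ)
  have cg : Continuous g := continuous_iff_continuousAt.2 fun t => (hg t).continuousAt
  have lim {k : ℝ → ℝ} (hk : Continuous k) :=
    tendsto_integral_mul_gaussian_marginal mℓ hab.le aeℓ hk
  have lim1 := lim (k := fun _ => 1) continuous_const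
  have limg := lim cg
  have limg2 := lim (cg.pow 2)
  have limg1 := lim (hg₁.pow 2)
  simp only [integral_const, one_mul, smul_eq_mul, mul_one, measureReal_restrict_apply_univ]
    at lim1
  refine le_of_tendsto_of_tendsto (((lim1.mul limg2).sub (limg.pow 2)).const_mul (κ ^ 2))
    (lim1.mul limg1) ?_
  filter_upwards [eventually_gt_atTop 0] with c hc
  have hK (t : ℝ) := hasDerivAt_gaussKernel c t
  have cK := continuous_gaussKernel c
  let K₁ : ℝ → ℝ := fun t => -(2 * π * c ^ 2) * (t * gaussKernel c t)
  let K₂ : ℝ → ℝ := fun t => -(2 * π * c ^ 2) *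
    (gaussKernel c t + t * (-(2 * π * c ^ 2) * (t * gaussKernel c t)))
  have cdK : ContDiff ℝ 1 (gaussKernel c) := by unfold gaussKernel; fun_prop
  have hK₁ (t : ℝ) : HasDerivAt K₁ (K₂ t) t :=
    (((hasDerivAt_id t).mul (hK t)).const_mul (-(2 * π * c ^ 2))).congr_deriv (by simp [K₂])
  have cdK₂ : ContDiff ℝ 1 K₂ := by fun_prop
  have hK₂ (t : ℝ) : HasDerivAt K₂ (deriv K₂ t) t :=
    (cdK₂.differentiable one_ne_zero t).hasDerivAt
  have hW := hasDerivAt_integral_comp_sub (K' := K₁) mℓ aeℓ hK (by fun_prop)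
  have hW₁ := hasDerivAt_integral_comp_sub mℓ aeℓ hK₁ cdK₂.continuous
  have hW₂ := hasDerivAt_integral_comp_sub mℓ aeℓ hK₂ (cdK₂.continuous_deriv le_rfl)
  have key := weighted_neumann_poincare hab hκ hκb hW hW₁
    (continuous_iff_continuousAt.2 fun t => (hW₂ t).continuousAt) (fun t => ?_)
    (mul_deriv2_le_sq_deriv hW hW₁ (gaussian_marginal_mul_le hA hconv hfin hc)) hg hg₁
  · simpa only [Pi.pow_apply] using key
  · refine (integral_pos_iff_support_of_nonneg (fun x => (gaussKernel_pos hc _).le) ?_).2 ?_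
    · refine Integrable.of_bound (C := c) ?_ (ae_of_all _ fun x => ?_)
      · exact (cK.comp (by fun_prop : Continuous fun x => t - ℓ x)).aestronglyMeasurable
      · rw [norm_of_nonneg (gaussKernel_pos hc _).le]; exact gaussKernel_le hc _
    · rw [Function.support_eq_univ fun x => (gaussKernel_pos hc _).ne']
      simpa [pos_iff_ne_zero] using h0

end Needle

section Localization

variable {n : ℕ}

theorem volume_linear_level_eq_zero {ℓ : EuclideanSpace ℝ (Fin n) →L[ℝ] ℝ} (hℓ : ℓ ≠ 0) (c : ℝ) :
    volume {x | ℓ x = c} = 0 := by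
  rcases eq_empty_or_nonempty {x | ℓ x = c} with h | ⟨x₀, hx₀⟩
  · rw [h, measure_empty]
  have h : {x | ℓ x = c} = (fun x => x + -x₀) ⁻¹' (LinearMap.ker ℓ.toLinearMap : Set _) := by
    ext x
    have : ℓ x₀ = c := hx₀
    simp [← sub_eq_add_neg, sub_eq_zero, this]
  rw [h, measure_preimage_add_right]
  refine Measure.addHaar_submodule _ _ fun htop => hℓ ?_
  ext x
  have : x ∈ LinearMap.ker ℓ.toLinearMap := htop ▸ Submodule.mem_top
  simpa using this

/-- The affine function `x ↦ cos θ (xᵢ - p) + sin θ (xⱼ - q)`, whose zero set is a hyperplane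
turning about the codimension two plane `xᵢ = p, xⱼ = q`. -/
noncomputable def rotForm (i j : Fin n) (p q θ : ℝ) (x : EuclideanSpace ℝ (Fin n)) : ℝ :=
  cos θ * (x i - p) + sin θ * (x j - q)

theorem continuous_rotForm (i j : Fin n) (p q θ : ℝ) : Continuous (rotForm i j p q θ) := by
  unfold rotForm; fun_prop

theorem rotForm_add_pi (i j : Fin n) (p q θ : ℝ) (x : EuclideanSpace ℝ (Fin n)) :
    rotForm i j p q (θ + π) x = -rotForm i j p q θ x := by
  simp [rotForm]; ring

theorem convex_rotForm_lt (i j : Fin n) (p q θ : ℝ) :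
    Convex ℝ {x | rotForm i j p q θ x < 0} := by
  intro x hx y hy a b ha hb hab
  simp only [rotForm, mem_ofPred_eq, PiLp.add_apply, PiLp.smul_apply, smul_eq_mul] at *
  have hb' : b = 1 - a := by linarith
  subst hb'
  rcases ha.eq_or_lt with rfl | ha
  · simpa using hy
  · nlinarith

theorem volume_rotForm_eq_zero {i j : Fin n} (hij : i ≠ j) (p q θ : ℝ) :
    volume {x | rotForm i j p q θ x = 0} = 0 := by
  let ℓ : EuclideanSpace ℝ (Fin n) →L[ℝ] ℝ :=
    cos θ • EuclideanSpace.proj i + sin θ • EuclideanSpace.proj j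
  have hℓ : ℓ ≠ 0 := fun h => by
    have h1 := DFunLike.congr_fun h (EuclideanSpace.single i 1)
    have h2 := DFunLike.congr_fun h (EuclideanSpace.single j 1)
    simp [ℓ, hij, hij.symm] at h1 h2
    have := sin_sq_add_cos_sq θ
    simp [h1, h2] at this
  convert volume_linear_level_eq_zero hℓ (cos θ * p + sin θ * q) using 2
  ext x
  simp only [rotForm, mem_ofPred_eq, ℓ, add_apply, smul_apply, PiLp.proj_apply,
    smul_eq_mul]
  constructor <;> intro h <;> linarith

theorem integral_inter_rotForm_add {i j : Fin n} (hij : i ≠ j) (p q θ : ℝ)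
    {A : Set (EuclideanSpace ℝ (Fin n))} {φ : EuclideanSpace ℝ (Fin n) → ℝ}
    (hφ : IntegrableOn φ A) :
    (∫ x in A ∩ {x | rotForm i j p q θ x < 0}, φ x) +
      ∫ x in A ∩ {x | rotForm i j p q (θ + π) x < 0}, φ x = ∫ x in A, φ x := by
  have hm : MeasurableSet {x | rotForm i j p q θ x < 0} :=
    (isOpen_lt (continuous_rotForm i j p q θ) continuous_const).measurableSet
  rw [← integral_inter_add_sdiff hm hφ]
  congr 1
  refine setIntegral_congr_set ?_
  have h0 : ∀ᵐ x : EuclideanSpace ℝ (Fin n), rotForm i j p q θ x ≠ 0 :=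
    ae_iff.2 (by simpa using volume_rotForm_eq_zero hij p q θ)
  filter_upwards [h0] with x hx
  refine propext (and_congr_right fun _ => ?_)
  change rotForm i j p q (θ + π) x < 0 ↔ ¬ rotForm i j p q θ x < 0
  rw [rotForm_add_pi, neg_lt_zero, not_lt]
  exact ⟨le_of_lt, fun h => h.lt_of_ne hx.symm⟩

theorem continuous_integral_inter_rotForm {i j : Fin n} (hij : i ≠ j) (p q : ℝ)
    {A : Set (EuclideanSpace ℝ (Fin n))} {φ : EuclideanSpace ℝ (Fin n) → ℝ}
    (hφ : IntegrableOn φ A) :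
    Continuous fun θ => ∫ x in A ∩ {x | rotForm i j p q θ x < 0}, φ x := by
  have hm (θ : ℝ) : MeasurableSet {x | rotForm i j p q θ x < 0} :=
    (isOpen_lt (continuous_rotForm i j p q θ) continuous_const).measurableSet
  have e (θ : ℝ) : ∫ x in A ∩ {x | rotForm i j p q θ x < 0}, φ x =
      ∫ x in A, {x | rotForm i j p q θ x < 0}.indicator φ x := by
    rw [integral_indicator (hm θ), Measure.restrict_restrict (hm θ), inter_comm]
  simp only [e]
  refine continuous_iff_continuousAt.2 fun θ => ?_
  refine continuousAt_of_dominated (bound := fun x => ‖φ x‖)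
    (Eventually.of_forall fun θ => (hφ.indicator (hm θ)).aestronglyMeasurable)
    (Eventually.of_forall fun θ => ae_of_all _ fun x => norm_indicator_le_norm_self _ _)
    hφ.norm ?_
  have h0 : ∀ᵐ x : EuclideanSpace ℝ (Fin n), rotForm i j p q θ x ≠ 0 :=
    ae_iff.2 (by simpa using volume_rotForm_eq_zero hij p q θ)
  filter_upwards [ae_restrict_of_ae h0] with x hx
  have hc : Continuous fun θ => rotForm i j p q θ x := by unfold rotForm; fun_prop
  rcases hx.lt_or_gt with h | h
  · refine (continuousAt_const (y := φ x)).congr ?_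
    filter_upwards [hc.continuousAt.eventually_lt continuousAt_const h] with θ' h'
    exact (indicator_of_mem (show x ∈ {x | rotForm i j p q θ' x < 0} from h') φ).symm
  · refine (continuousAt_const (y := (0 : ℝ))).congr ?_
    filter_upwards [continuousAt_const.eventually_lt hc.continuousAt h] with θ' h'
    exact (indicator_of_notMem (show x ∉ {x | rotForm i j p q θ' x < 0} from h'.le.not_gt) φ).symm

/-- The sets kept in the bisection scheme: open convex pieces of `Ω` on which `f` has zero integral
and `G` negative integral. -/
structure IsPiece (Ω : Set (EuclideanSpace ℝ (Fin n))) (f G : EuclideanSpace ℝ (Fin n) → ℝ)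
    (A : Set (EuclideanSpace ℝ (Fin n))) : Prop where
  subset : A ⊆ Ω
  isOpen : IsOpen A
  convex : Convex ℝ A
  integral_eq : ∫ x in A, f x = 0
  integral_neg : ∫ x in A, G x < 0

variable {Ω A : Set (EuclideanSpace ℝ (Fin n))} {f G : EuclideanSpace ℝ (Fin n) → ℝ}

theorem IsPiece.bisect (hf : IntegrableOn f Ω) (hG : IntegrableOn G Ω) (hA : IsPiece Ω f G A)
    {i j : Fin n} (hij : i ≠ j) (p q : ℝ) :
    ∃ A' ⊆ A, IsPiece Ω f G A' ∧ ∃ θ, ∀ x ∈ A', rotForm i j p q θ x < 0 := by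
  have hfA := hf.mono_set hA.subset
  have hGA := hG.mono_set hA.subset
  have hcont := continuous_integral_inter_rotForm hij p q hfA
  have piece (θ : ℝ) (h1 : ∫ x in A ∩ {x | rotForm i j p q θ x < 0}, f x = 0)
      (h2 : ∫ x in A ∩ {x | rotForm i j p q θ x < 0}, G x < 0) :
      ∃ A' ⊆ A, IsPiece Ω f G A' ∧ ∃ θ, ∀ x ∈ A', rotForm i j p q θ x < 0 :=
    ⟨_, inter_subset_left, ⟨inter_subset_left.trans hA.subset,
      hA.isOpen.inter (isOpen_lt (continuous_rotForm i j p q θ) continuous_const),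
      hA.convex.inter (convex_rotForm_lt i j p q θ), h1, h2⟩, θ, fun x hx => hx.2⟩
  have hsum (θ : ℝ) := (integral_inter_rotForm_add hij p q θ hfA).trans hA.integral_eq
  obtain ⟨θ, hθ⟩ : (0 : ℝ) ∈ range fun θ => ∫ x in A ∩ {x | rotForm i j p q θ x < 0}, f x := by
    have h0 := hsum 0
    rcases le_total (∫ x in A ∩ {x | rotForm i j p q 0 x < 0}, f x) 0 with h | h
    · exact mem_range_of_exists_le_of_exists_ge hcont ⟨0, h⟩ ⟨0 + π, by linarith⟩
    · exact mem_range_of_exists_le_of_exists_ge hcont ⟨0 + π, by linarith⟩ ⟨0, h⟩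
  simp only at hθ
  have hGsum := integral_inter_rotForm_add hij p q θ hGA
  have hneg := hA.integral_neg
  rcases lt_or_ge (∫ x in A ∩ {x | rotForm i j p q θ x < 0}, G x) 0 with h | h
  · exact piece θ hθ h
  · exact piece (θ + π) (by linarith [hsum θ]) (by linarith)

theorem IsPiece.exists_antitone_seq (hf : IntegrableOn f Ω) (hG : IntegrableOn G Ω)
    (hΩ : IsPiece Ω f G Ω) :
    ∃ A : ℕ → Set (EuclideanSpace ℝ (Fin n)), (∀ k, IsPiece Ω f G (A k)) ∧ Antitone A ∧
      ∀ i j : Fin n, i ≠ j → ∀ p q : ℚ, ∃ k θ, ∀ x ∈ A k, rotForm i j p q θ x < 0 := by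
  obtain hn | hn := isEmpty_or_nonempty (Fin n)
  · exact ⟨fun _ => Ω, fun _ => hΩ, antitone_const, fun i => hn.elim i⟩
  obtain ⟨e, he⟩ := exists_surjective_nat (Fin n × Fin n × ℚ × ℚ)
  have step (k : ℕ) (A : {A // IsPiece Ω f G A}) : ∃ A' : {A // IsPiece Ω f G A},
      A'.1 ⊆ A.1 ∧ ((e k).1 ≠ (e k).2.1 →
        ∃ θ, ∀ x ∈ A'.1, rotForm (e k).1 (e k).2.1 (e k).2.2.1 (e k).2.2.2 θ x < 0) := by
    by_cases h : (e k).1 = (e k).2.1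
    · exact ⟨A, Subset.rfl, fun h' => (h' h).elim⟩
    · obtain ⟨A', h1, h2, h3⟩ := A.2.bisect hf hG h (e k).2.2.1 (e k).2.2.2
      exact ⟨⟨A', h2⟩, h1, fun _ => h3⟩
  choose next hnext using step
  let A : ℕ → {A // IsPiece Ω f G A} := fun k => Nat.rec ⟨Ω, hΩ⟩ next k
  refine ⟨fun k => (A k).1, fun k => (A k).2, antitone_nat_of_succ_le fun k => (hnext k (A k)).1,
    fun i j hij p q => ?_⟩
  obtain ⟨k, hk⟩ := he (i, j, p, q)
  have := (hnext k (A k)).2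
  simp only [hk] at this
  obtain ⟨θ, hθ⟩ := this hij
  exact ⟨k + 1, θ, hθ⟩

theorem minor_eq_zero_of_rotForm {K : Set (EuclideanSpace ℝ (Fin n))} {i j : Fin n}
    (hK : ∀ p q : ℚ, ∃ θ, ∀ x ∈ K, rotForm i j p q θ x ≤ 0)
    {a b x : EuclideanSpace ℝ (Fin n)} (ha : a ∈ K) (hb : b ∈ K) (hx : x ∈ K) :
    (b i - a i) * (x j - a j) = (b j - a j) * (x i - a i) := by
  by_contra hne
  set D := (b i - a i) * (x j - a j) - (b j - a j) * (x i - a i) with hD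
  have hD0 : D ≠ 0 := sub_ne_zero.2 hne
  let s : ℝ × ℝ → ℝ := fun z => ((z.1 - a i) * (x j - a j) - (z.2 - a j) * (x i - a i)) / D
  let t : ℝ × ℝ → ℝ := fun z => ((b i - a i) * (z.2 - a j) - (b j - a j) * (z.1 - a i)) / D
  have hs : Continuous s := by fun_prop
  have ht : Continuous t := by fun_prop
  have hopen : IsOpen {z | 0 < s z ∧ 0 < t z ∧ s z + t z < 1} :=
    (isOpen_lt continuous_const hs).inter
      ((isOpen_lt continuous_const ht).inter (isOpen_lt (hs.add ht) continuous_const))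
  have hdense : DenseRange (Prod.map ((↑) : ℚ → ℝ) ((↑) : ℚ → ℝ)) :=
    Rat.denseRange_cast.prodMap Rat.denseRange_cast
  obtain ⟨⟨p, q⟩, h1, h2, h3⟩ := hdense.exists_mem_open hopen
    ⟨((a i + b i + x i) / 3, (a j + b j + x j) / 3), by
      have e1 : s ((a i + b i + x i) / 3, (a j + b j + x j) / 3) = 1 / 3 := by
        simp only [s]; rw [div_eq_iff hD0, hD]; ring
      have e2 : t ((a i + b i + x i) / 3, (a j + b j + x j) / 3) = 1 / 3 := by
        simp only [t]; rw [div_eq_iff hD0, hD]; ring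
      rw [mem_ofPred_eq, e1, e2]; norm_num⟩
  obtain ⟨θ, hθ⟩ := hK p q
  have la := hθ a ha
  have lb := hθ b hb
  have lx := hθ x hx
  have sD : s (p, q) * D = (p - a i) * (x j - a j) - (q - a j) * (x i - a i) :=
    div_mul_cancel₀ _ hD0
  have tD : t (p, q) * D = (b i - a i) * (q - a j) - (b j - a j) * (p - a i) :=
    div_mul_cancel₀ _ hD0
  simp only [Prod.map] at h1 h2 h3
  set σ := s (p, q)
  set τ := t (p, q)
  have key : (1 - σ - τ) * rotForm i j p q θ a + σ * rotForm i j p q θ b +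
      τ * rotForm i j p q θ x = 0 := by
    refine mul_right_cancel₀ hD0 ?_
    simp only [rotForm]
    linear_combination (cos θ * (b i - a i) + sin θ * (b j - a j)) * sD +
      (cos θ * (x i - a i) + sin θ * (x j - a j)) * tD +
      (cos θ * (a i - p) + sin θ * (a j - q)) * hD
  have la0 : rotForm i j p q θ a = 0 := by nlinarith
  have lb0 : rotForm i j p q θ b = 0 := by nlinarith
  have lx0 : rotForm i j p q θ x = 0 := by nlinarith
  have hb' : cos θ * (b i - a i) + sin θ * (b j - a j) = 0 := by
    simp only [rotForm] at *; linarith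
  have hx' : cos θ * (x i - a i) + sin θ * (x j - a j) = 0 := by
    simp only [rotForm] at *; linarith
  have hcos : cos θ * D = 0 := by
    rw [hD]; linear_combination (x j - a j) * hb' - (b j - a j) * hx'
  have hsin : sin θ * D = 0 := by
    rw [hD]; linear_combination (b i - a i) * hx' - (x i - a i) * hb'
  have := sin_sq_add_cos_sq θ
  simp only [mul_eq_zero, hD0, or_false] at hcos hsin
  simp [hcos, hsin] at this

open scoped RealInnerProductSpace in
theorem eq_inner_smul_of_minor {w z : EuclideanSpace ℝ (Fin n)} (hw : w ≠ 0)
    (h : ∀ i j, w i * z j = w j * z i) : z = ⟪‖w‖⁻¹ • w, z⟫ • ‖w‖⁻¹ • w := by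
  have hw' : ‖w‖ ≠ 0 := norm_ne_zero_iff.2 hw
  have key : ‖w‖ ^ 2 • z = ⟪w, z⟫ • w := by
    ext j
    simp only [PiLp.smul_apply, smul_eq_mul, EuclideanSpace.real_norm_sq_eq,
      PiLp.inner_apply, Finset.sum_mul]
    refine Finset.sum_congr rfl fun i _ => ?_
    simp
    linear_combination (w i) * h i j
  rw [real_inner_smul_left, smul_smul, mul_right_comm, mul_comm, ← smul_smul, smul_comm, ← key,
    smul_smul, ← mul_inv, ← sq, inv_mul_cancel₀ (pow_ne_zero 2 hw'), one_smul]

open scoped RealInnerProductSpace in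
/-- Every integral inequality localises to pieces arbitrarily close to a line. -/
theorem IsPiece.exists_near_line (hn : 0 < n) (hb : Bornology.IsBounded Ω)
    (hf : IntegrableOn f Ω) (hG : IntegrableOn G Ω) (hΩ : IsPiece Ω f G Ω) {δ : ℝ} (hδ : 0 < δ) :
    ∃ A a e, IsPiece Ω f G A ∧ ‖e‖ = 1 ∧ ∀ x ∈ A, ‖x - (a + ⟪e, x - a⟫ • e)‖ < δ := by
  obtain ⟨A, hA, hanti, hcut⟩ := hΩ.exists_antitone_seq hf hG
  have hcomp (k : ℕ) : IsCompact (closure (A k)) := (hb.subset (hA k).subset).isCompact_closure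
  let K := ⋂ k, closure (A k)
  have hminor {i j : Fin n} {a b x : EuclideanSpace ℝ (Fin n)} (ha : a ∈ K) (hb : b ∈ K)
      (hx : x ∈ K) : (b i - a i) * (x j - a j) = (b j - a j) * (x i - a i) := by
    rcases eq_or_ne i j with rfl | hij
    · rfl
    refine minor_eq_zero_of_rotForm (fun p q => ?_) ha hb hx
    obtain ⟨k, θ, hθ⟩ := hcut i j hij p q
    exact ⟨θ, fun y hy => closure_minimal (fun z hz => (hθ z hz).le)
      (isClosed_le (continuous_rotForm i j p q θ) continuous_const) (mem_iInter.1 hy k)⟩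
  have hline : ∃ a e : EuclideanSpace ℝ (Fin n), ‖e‖ = 1 ∧
      ∀ x ∈ K, x - (a + ⟪e, x - a⟫ • e) = 0 := by
    by_cases hK : K.Subsingleton
    · have he : ‖EuclideanSpace.single (⟨0, hn⟩ : Fin n) (1 : ℝ)‖ = 1 := by simp
      obtain h | ⟨a, h⟩ := hK.eq_empty_or_singleton
      · exact ⟨0, _, he, by simp [h]⟩
      · exact ⟨a, _, he, by simp [h]⟩
    · rw [not_subsingleton_iff] at hK
      obtain ⟨a, ha, b, hb, hab⟩ := hK
      have hw : b - a ≠ 0 := sub_ne_zero.2 hab.symm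
      refine ⟨a, ‖b - a‖⁻¹ • (b - a), by simp [norm_smul, hw], fun x hx => ?_⟩
      rw [← sub_sub, sub_eq_zero]
      exact eq_inner_smul_of_minor hw fun i j => hminor ha hb hx
  obtain ⟨a, e, he, hae⟩ := hline
  obtain ⟨k, hk⟩ := exists_subset_nhds_of_isCompact (V := fun k => closure (A k))
    (directed_of_isDirected_le fun i j hij => closure_mono (hanti hij)) hcomp
    (U := {x | ‖x - (a + ⟪e, x - a⟫ • e)‖ < δ}) fun x hx => by
      refine (isOpen_lt (by fun_prop) continuous_const).mem_nhds ?_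
      rw [mem_ofPred_eq, hae x hx, norm_zero]
      exact hδ
  exact ⟨A k, a, e, hA k, he, fun x hx => hk (subset_closure hx)⟩

end Localization

section Smooth

variable {n : ℕ} {Ω : Set (EuclideanSpace ℝ (Fin n))}

theorem Continuous.integrableOn_of_isBounded {F : EuclideanSpace ℝ (Fin n) → ℝ}
    (hF : Continuous F) {A : Set (EuclideanSpace ℝ (Fin n))} (hA : Bornology.IsBounded A) :
    IntegrableOn F A :=
  (hF.continuousOn.integrableOn_compact hA.isCompact_closure).mono_set subset_closure

theorem Continuous.exists_near_of_isBounded {F : EuclideanSpace ℝ (Fin n) → ℝ}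
    (hF : Continuous F) (hb : Bornology.IsBounded Ω) {η : ℝ} (hη : 0 < η) :
    ∃ δ > 0, ∀ x ∈ Ω, ∀ y, ‖x - y‖ < δ → |F x - F y| < η := by
  have hC : IsCompact (Metric.cthickening 1 Ω) :=
    Metric.isCompact_of_isClosed_isBounded Metric.isClosed_cthickening hb.cthickening
  obtain ⟨δ, hδ, h⟩ := Metric.uniformContinuousOn_iff.1
    (hC.uniformContinuousOn_of_continuous hF.continuousOn) η hη
  refine ⟨min δ 1, lt_min hδ one_pos, fun x hx y hxy => ?_⟩
  rw [← dist_eq_norm] at hxy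
  refine h x (Metric.self_subset_cthickening Ω hx) y ?_ (hxy.trans_le (min_le_left _ _))
  exact Metric.mem_cthickening_of_dist_le y x 1 Ω hx
    ((dist_comm y x).trans_le (hxy.le.trans (min_le_right _ _)))

open scoped RealInnerProductSpace in
/-- The Poincaré inequality with an error term for a convex set close to a line. -/
theorem poincare_of_near_line {A : Set (EuclideanSpace ℝ (Fin n))} (hA : IsOpen A)
    (hb : Bornology.IsBounded A) (hc : Convex ℝ A) {u : EuclideanSpace ℝ (Fin n) → ℝ}
    (hu : ContDiff ℝ 1 u) (hmean : ∫ x in A, u x = 0) {κ η D : ℝ} (hκ : 0 < κ)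
    (hκD : κ * D < π) (hD : ∀ x ∈ A, ∀ y ∈ A, ‖x - y‖ ≤ D)
    {a e : EuclideanSpace ℝ (Fin n)} (he : ‖e‖ = 1)
    (h1 : ∀ x ∈ A, |u x - u (a + ⟪e, x - a⟫ • e)| ≤ η)
    (h2 : ∀ x ∈ A, |u x ^ 2 - u (a + ⟪e, x - a⟫ • e) ^ 2| ≤ η)
    (h3 : ∀ x ∈ A, |‖fderiv ℝ u x‖ ^ 2 - ‖fderiv ℝ u (a + ⟪e, x - a⟫ • e)‖ ^ 2| ≤ η) :
    κ ^ 2 * (∫ x in A, u x ^ 2) ≤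
      (∫ x in A, ‖fderiv ℝ u x‖ ^ 2) + (η + κ ^ 2 * η + κ ^ 2 * η ^ 2) * volume.real A := by
  rcases A.eq_empty_or_nonempty with rfl | hne
  · simp
  have hD0 : 0 ≤ D := by
    obtain ⟨x, hx⟩ := hne
    exact (norm_nonneg _).trans (hD x hx x hx)
  have hpos : 0 < volume.real A := by
    rw [measureReal_def]
    exact ENNReal.toReal_pos (hA.measure_pos volume hne).ne' hb.measure_lt_top.ne
  have hm := hA.measurableSet
  have cu := hu.continuous
  have cu' := hu.continuous_fderiv one_ne_zero
  let P : EuclideanSpace ℝ (Fin n) → EuclideanSpace ℝ (Fin n) := fun x => a + ⟪e, x - a⟫ • e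
  have cP : Continuous P := by fun_prop
  let ℓ := innerSL ℝ e
  let γ : ℝ → EuclideanSpace ℝ (Fin n) := fun t => a + (t - ⟪e, a⟫) • e
  have hγ (t : ℝ) : HasDerivAt γ e t :=
    ((((hasDerivAt_id t).sub_const _).smul_const e).const_add a).congr_deriv (by simp)
  have cγ : Continuous γ := by fun_prop
  have hγℓ (x) : γ (ℓ x) = P x := by simp [γ, ℓ, P, inner_sub_right]
  let ρ := (π - κ * D) / (4 * κ)
  have hρ : 0 < ρ := div_pos (by linarith) (by linarith)
  have hρκ : κ * (4 * ρ) = π - κ * D := by simp only [ρ]; field_simp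
  have hℓD (x) (hx : x ∈ A) (y) (hy : y ∈ A) : ℓ x - ℓ y ≤ D := by
    rw [← map_sub]
    exact (real_inner_le_norm e (x - y)).trans (by rw [he, one_mul]; exact hD x hx y hy)
  have hbdd : BddBelow (ℓ '' A) := by
    obtain ⟨x, hx⟩ := hne
    refine ⟨ℓ x - D, ?_⟩
    rintro _ ⟨y, hy, rfl⟩
    linarith [hℓD x hx y hy]
  have key := needle_poincare (ℓ := ℓ) (g := u ∘ γ) (g₁ := fun t => fderiv ℝ u (γ t) e)
    (a := sInf (ℓ '' A) - ρ) (b := sInf (ℓ '' A) + D + ρ) hm hc hb.measure_lt_top.ne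
    (by linarith) hκ (by nlinarith) (fun x hx => ⟨?_, ?_⟩)
    (fun t => ((hu.differentiable one_ne_zero _).hasFDerivAt.comp_hasDerivAt t (hγ t)))
    (by fun_prop)
  rotate_left
  · linarith [csInf_le hbdd (mem_image_of_mem ℓ hx)]
  · have : ℓ x - D ≤ sInf (ℓ '' A) := by
      refine le_csInf (hne.image ℓ) ?_
      rintro _ ⟨y, hy, rfl⟩
      linarith [hℓD x hx y hy]
    linarith
  simp only [Function.comp_apply, hγℓ] at key
  have iu : IntegrableOn u A := cu.integrableOn_of_isBounded hb
  have iu2 : IntegrableOn (fun x => u x ^ 2) A :=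
    (cu.pow 2).integrableOn_of_isBounded hb
  have iP : IntegrableOn (fun x => u (P x)) A :=
    (cu.comp cP).integrableOn_of_isBounded hb
  have iP2 : IntegrableOn (fun x => u (P x) ^ 2) A :=
    ((cu.comp cP).pow 2).integrableOn_of_isBounded hb
  have iu' : IntegrableOn (fun x => ‖fderiv ℝ u x‖ ^ 2) A :=
    (cu'.norm.pow 2).integrableOn_of_isBounded hb
  have iP' : IntegrableOn (fun x => (fderiv ℝ u (P x) e) ^ 2) A :=
    Continuous.integrableOn_of_isBounded (by fun_prop) hb
  have ic (c : ℝ) : IntegrableOn (fun _ : EuclideanSpace ℝ (Fin n) => c) A :=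
    continuous_const.integrableOn_of_isBounded hb
  have vol (c : ℝ) : ∫ x in A, c = c * volume.real A := by simp [mul_comm]
  have b1 : |∫ x in A, u (P x)| ≤ η * volume.real A := by
    have : ∫ x in A, u (P x) = ∫ x in A, (u (P x) - u x) := by
      rw [integral_sub iP iu, hmean, sub_zero]
    rw [this, ← Real.norm_eq_abs]
    refine norm_setIntegral_le_of_norm_le_const hb.measure_lt_top fun x hx => ?_
    rw [Real.norm_eq_abs, abs_sub_comm]
    exact h1 x hx
  have b2 : (∫ x in A, u x ^ 2) ≤ (∫ x in A, u (P x) ^ 2) + η * volume.real A := by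
    rw [← vol, ← integral_add iP2 (ic η)]
    refine setIntegral_mono_on iu2 (iP2.add (ic η)) hm fun x hx => ?_
    have := (abs_le.1 (h2 x hx)).2
    simp only [P]
    linarith
  have b3 : (∫ x in A, (fderiv ℝ u (P x) e) ^ 2) ≤
      (∫ x in A, ‖fderiv ℝ u x‖ ^ 2) + η * volume.real A := by
    rw [← vol, ← integral_add iu' (ic η)]
    refine setIntegral_mono_on iP' (iu'.add (ic η)) hm fun x hx => ?_
    have h := (abs_le.1 (h3 x hx)).1
    have h' : (fderiv ℝ u (P x) e) ^ 2 ≤ ‖fderiv ℝ u (P x)‖ ^ 2 := by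
      rw [← sq_abs, ← Real.norm_eq_abs]
      gcongr
      simpa [he] using (fderiv ℝ u (P x)).le_opNorm e
    simp only [P] at h' ⊢
    linarith
  have b1' : (∫ x in A, u (P x)) ^ 2 ≤ (η * volume.real A) ^ 2 :=
    sq_le_sq' (abs_le.1 b1).1 (abs_le.1 b1).2
  refine le_of_mul_le_mul_left ?_ hpos
  have e2 := mul_le_mul_of_nonneg_left b2 (mul_nonneg (sq_nonneg κ) hpos.le)
  have e3 := mul_le_mul_of_nonneg_left b3 hpos.le
  have e1 := mul_le_mul_of_nonneg_left b1' (sq_nonneg κ)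
  linarith

open scoped RealInnerProductSpace in
theorem poincare_of_contDiff (hn : 0 < n) (ho : IsOpen Ω) (hb : Bornology.IsBounded Ω)
    (hc : Convex ℝ Ω) {u : EuclideanSpace ℝ (Fin n) → ℝ} (hu : ContDiff ℝ 1 u)
    (hmean : ∫ x in Ω, u x = 0) {κ : ℝ} (hκ : 0 < κ) (hκD : κ * Metric.diam Ω < π) :
    κ ^ 2 * (∫ x in Ω, u x ^ 2) ≤ ∫ x in Ω, ‖fderiv ℝ u x‖ ^ 2 := by
  by_contra! hlt
  have cu := hu.continuous
  have cu' := hu.continuous_fderiv one_ne_zero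
  have iu {A} (hA : A ⊆ Ω) : IntegrableOn (fun x => u x ^ 2) A :=
    (cu.pow 2).integrableOn_of_isBounded (hb.subset hA)
  have iu' {A} (hA : A ⊆ Ω) : IntegrableOn (fun x => ‖fderiv ℝ u x‖ ^ 2) A :=
    (cu'.norm.pow 2).integrableOn_of_isBounded (hb.subset hA)
  have ic {A} (hA : A ⊆ Ω) (c : ℝ) : IntegrableOn (fun _ : EuclideanSpace ℝ (Fin n) => c) A :=
    continuous_const.integrableOn_of_isBounded (hb.subset hA)
  set d := κ ^ 2 * (∫ x in Ω, u x ^ 2) - ∫ x in Ω, ‖fderiv ℝ u x‖ ^ 2 with hd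
  have hd0 : 0 < d := sub_pos.2 hlt
  set V := volume.real Ω
  have hV : 0 ≤ V := measureReal_nonneg
  let c := d / (V + 1)
  have hc0 : 0 < c := by positivity
  have hcV : c * V < d := by
    have : c * (V + 1) = d := div_mul_cancel₀ _ (by positivity)
    linarith
  let G : EuclideanSpace ℝ (Fin n) → ℝ := fun x => ‖fderiv ℝ u x‖ ^ 2 - κ ^ 2 * u x ^ 2 + c
  have hG {A} (hA : A ⊆ Ω) : ∫ x in A, G x = (∫ x in A, ‖fderiv ℝ u x‖ ^ 2) -
      κ ^ 2 * (∫ x in A, u x ^ 2) + c * volume.real A := by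
    have hsub : IntegrableOn (fun x => ‖fderiv ℝ u x‖ ^ 2 - κ ^ 2 * u x ^ 2) A :=
      (iu' hA).sub ((iu hA).const_mul _)
    simp only [G]
    rw [integral_add hsub (ic hA c), integral_sub (iu' hA) ((iu hA).const_mul _), integral_const_mul]
    simp [mul_comm]
  have hΩ : IsPiece Ω u G Ω :=
    ⟨Subset.rfl, ho, hc, hmean, by rw [hG Subset.rfl]; linarith⟩
  let η := min 1 (c / (1 + 2 * κ ^ 2))
  have hη : 0 < η := by positivity
  have hη1 : η + κ ^ 2 * η + κ ^ 2 * η ^ 2 ≤ c := by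
    have e1 : η ≤ 1 := min_le_left _ _
    have e2 : η * (1 + 2 * κ ^ 2) ≤ c := (le_div_iff₀ (by positivity)).1 (min_le_right _ _)
    have e3 : κ ^ 2 * η ^ 2 ≤ κ ^ 2 * η := by
      gcongr
      nlinarith
    linarith
  obtain ⟨δ₁, hδ₁, h1⟩ := cu.exists_near_of_isBounded hb hη
  obtain ⟨δ₂, hδ₂, h2⟩ := (cu.pow 2).exists_near_of_isBounded hb hη
  obtain ⟨δ₃, hδ₃, h3⟩ := (cu'.norm.pow 2).exists_near_of_isBounded hb hη
  obtain ⟨A, a, e, hA, he, hline⟩ := hΩ.exists_near_line hn hb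
    (cu.integrableOn_of_isBounded hb)
    (Continuous.integrableOn_of_isBounded (by fun_prop) hb)
    (lt_min hδ₁ (lt_min hδ₂ hδ₃))
  have key := poincare_of_near_line hA.isOpen (hb.subset hA.subset) hA.convex hu hA.integral_eq
    hκ hκD (fun x hx y hy => dist_eq_norm x y ▸
      Metric.dist_le_diam_of_mem hb (hA.subset hx) (hA.subset hy)) he
    (fun x hx => (h1 x (hA.subset hx) _ ((hline x hx).trans_le (by simp))).le)
    (fun x hx => (h2 x (hA.subset hx) _ ((hline x hx).trans_le (by simp))).le)
    (fun x hx => (h3 x (hA.subset hx) _ ((hline x hx).trans_le (by simp))).le)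
  have hneg := hA.integral_neg
  rw [hG hA.subset] at hneg
  have := mul_le_mul_of_nonneg_right hη1 (measureReal_nonneg (μ := volume) (s := A))
  linarith

end Smooth

section Lipschitz

variable {n : ℕ} {Ω : Set (EuclideanSpace ℝ (Fin n))} {u : EuclideanSpace ℝ (Fin n) → ℝ}

/-- The variance form of `poincare_of_contDiff`. -/
theorem variance_poincare_of_contDiff (hn : 0 < n) (ho : IsOpen Ω) (hb : Bornology.IsBounded Ω)
    (hc : Convex ℝ Ω) (hu : ContDiff ℝ 1 u) {κ : ℝ} (hκ : 0 < κ) (hκD : κ * Metric.diam Ω < π) :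
    κ ^ 2 * (volume.real Ω * (∫ x in Ω, u x ^ 2) - (∫ x in Ω, u x) ^ 2) ≤
      volume.real Ω * ∫ x in Ω, ‖fderiv ℝ u x‖ ^ 2 := by
  rcases eq_or_ne (volume.real Ω) 0 with h0 | h0
  · rw [h0]
    nlinarith [mul_nonneg (sq_nonneg κ) (sq_nonneg (∫ x in Ω, u x))]
  have hpos : 0 < volume.real Ω := measureReal_nonneg.lt_of_ne h0.symm
  set m := (∫ x in Ω, u x) / volume.real Ω with hm
  have hmV : m * volume.real Ω = ∫ x in Ω, u x := div_mul_cancel₀ _ h0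
  have iu : IntegrableOn u Ω := hu.continuous.integrableOn_of_isBounded hb
  have iu2 : IntegrableOn (fun x => u x ^ 2) Ω :=
    (hu.continuous.pow 2).integrableOn_of_isBounded hb
  have ic (c : ℝ) : IntegrableOn (fun _ : EuclideanSpace ℝ (Fin n) => c) Ω :=
    continuous_const.integrableOn_of_isBounded hb
  have vol (c : ℝ) : ∫ x in Ω, c = c * volume.real Ω := by simp [mul_comm]
  have key := poincare_of_contDiff hn ho hb hc (hu.sub (contDiff_const (c := m)))
    (by rw [integral_sub iu (ic m), vol, hmV, sub_self]) hκ hκD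
  have e : ∫ x in Ω, (u x - m) ^ 2 = (∫ x in Ω, u x ^ 2) - m * ∫ x in Ω, u x := by
    have i1 : IntegrableOn (fun x => u x ^ 2 - 2 * m * u x) Ω := iu2.sub (iu.const_mul _)
    calc ∫ x in Ω, (u x - m) ^ 2 = ∫ x in Ω, (u x ^ 2 - 2 * m * u x + m ^ 2) := by
          congr 1; ext x; ring
      _ = _ := by
          rw [integral_add i1 (ic _), integral_sub iu2 (iu.const_mul _), integral_const_mul, vol,
            ← hmV]
          ring
  simp only [fderiv_sub_const, e] at key
  have := mul_le_mul_of_nonneg_left key hpos.le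
  rw [← hmV] at this ⊢
  linarith

open scoped Convolution
open ContinuousLinearMap (lsmul)

theorem LipschitzWith.hasFDerivAt_bump_convolution {K : NNReal} (hu : LipschitzWith K u)
    (φ : ContDiffBump (0 : EuclideanSpace ℝ (Fin n))) (x : EuclideanSpace ℝ (Fin n)) :
    HasFDerivAt (φ.normed volume ⋆[lsmul ℝ ℝ, volume] u)
      ((φ.normed volume ⋆[lsmul ℝ ℝ, volume] fderiv ℝ u) x) x := by
  have cφ : Continuous (φ.normed volume) := φ.continuous_normed
  have iφ : Integrable (φ.normed volume) := φ.integrable_normed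
  have cF (y) : Continuous fun t => φ.normed volume t • u (y - t) :=
    cφ.smul (hu.continuous.comp (by fun_prop))
  refine (hasFDerivAt_integral_of_dominated_loc_of_lip (s := univ)
    (F := fun y t => φ.normed volume t • u (y - t))
    (F' := fun t => φ.normed volume t • fderiv ℝ u (x - t))
    (bound := fun t => φ.normed volume t * K) univ_mem
    (Eventually.of_forall fun y => (cF y).aestronglyMeasurable) ?_ ?_
    (ae_of_all _ fun t => ?_) (iφ.mul_const _) ?_).2
  · exact (cF x).integrable_of_hasCompactSupport (φ.hasCompactSupport_normed.smul_right)
  · exact cφ.aestronglyMeasurable.smul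
      ((measurable_fderiv ℝ u).comp (measurable_const.sub measurable_id)).aestronglyMeasurable
  · refine LipschitzOnWith.of_dist_le_mul fun y _ z _ => ?_
    have h := hu.dist_le_mul (y - t) (z - t)
    rw [dist_sub_right] at h
    have e : (nnabs (φ.normed volume t * K) : ℝ) = φ.normed volume t * K :=
      abs_of_nonneg (mul_nonneg (φ.nonneg_normed t) K.2)
    rw [dist_smul₀, e, mul_assoc, norm_of_nonneg (φ.nonneg_normed t)]
    exact mul_le_mul_of_nonneg_left h (φ.nonneg_normed t)
  · have := (Measure.measurePreserving_sub_left volume x).quasiMeasurePreserving.ae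
      hu.ae_differentiableAt
    filter_upwards [this] with t ht
    have h := ht.hasFDerivAt.comp x ((hasFDerivAt_id x).sub_const t)
    rw [ContinuousLinearMap.comp_id] at h
    exact h.const_smul (φ.normed volume t)

theorem LipschitzWith.norm_fderiv_bump_convolution_le {K : NNReal} (hu : LipschitzWith K u)
    (φ : ContDiffBump (0 : EuclideanSpace ℝ (Fin n))) (x : EuclideanSpace ℝ (Fin n)) :
    ‖(φ.normed volume ⋆[lsmul ℝ ℝ, volume] fderiv ℝ u) x‖ ≤ K := by
  have iφ : Integrable (φ.normed volume) := φ.integrable_normed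
  calc _ ≤ ∫ t, φ.normed volume t * K := by
        refine norm_integral_le_of_norm_le (iφ.mul_const _) (ae_of_all _ fun t => ?_)
        rw [ContinuousLinearMap.lsmul_apply, norm_smul, norm_of_nonneg (φ.nonneg_normed t)]
        exact mul_le_mul_of_nonneg_left (norm_fderiv_le_of_lipschitz ℝ hu) (φ.nonneg_normed t)
    _ = K := by rw [integral_mul_const, φ.integral_normed, one_mul]

theorem poincare_of_lipschitz (hn : 0 < n) (ho : IsOpen Ω) (hb : Bornology.IsBounded Ω)
    (hc : Convex ℝ Ω) {K : NNReal} (hu : LipschitzWith K u) (hmean : ∫ x in Ω, u x = 0) {κ : ℝ}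
    (hκ : 0 < κ) (hκD : κ * Metric.diam Ω < π) :
    κ ^ 2 * (∫ x in Ω, u x ^ 2) ≤ ∫ x in Ω, ‖fderiv ℝ u x‖ ^ 2 := by
  rcases Ω.eq_empty_or_nonempty with rfl | hne
  · simp
  have hpos : 0 < volume.real Ω := by
    rw [measureReal_def]
    exact ENNReal.toReal_pos (ho.measure_pos volume hne).ne' hb.measure_lt_top.ne
  have : IsFiniteMeasure (volume.restrict Ω) := ⟨by simpa using hb.measure_lt_top⟩
  have hm := ho.measurableSet
  let φ : ℕ → ContDiffBump (0 : EuclideanSpace ℝ (Fin n)) := fun k =>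
    ⟨1 / (k + 1), 2 * (1 / (k + 1)), by positivity,
      by have : (0 : ℝ) < 1 / (k + 1) := by positivity
         linarith⟩
  have hφ : Tendsto (fun k => (φ k).rOut) atTop (𝓝 0) := by
    have := (tendsto_one_div_add_atTop_nhds_zero_nat (𝕜 := ℝ)).const_mul 2
    rwa [mul_zero] at this
  have hφ2 (k : ℕ) : (φ k).rOut ≤ 2 := by
    have : (1 : ℝ) / (k + 1) ≤ 1 := by
      rw [div_le_one (by positivity)]
      linarith [k.cast_nonneg (α := ℝ)]
    change 2 * ((1 : ℝ) / (k + 1)) ≤ 2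
    linarith
  let v : ℕ → EuclideanSpace ℝ (Fin n) → ℝ := fun k =>
    (φ k).normed volume ⋆[lsmul ℝ ℝ, volume] u
  have hv (k : ℕ) : ContDiff ℝ 1 (v k) :=
    (φ k).hasCompactSupport_normed.contDiff_convolution_left _ (φ k).contDiff_normed
      hu.continuous.locallyIntegrable
  have hv' (k : ℕ) (x) : fderiv ℝ (v k) x =
      ((φ k).normed volume ⋆[lsmul ℝ ℝ, volume] fderiv ℝ u) x :=
    (hu.hasFDerivAt_bump_convolution (φ k) x).fderiv
  have near (k : ℕ) (x) : dist (v k x) (u x) ≤ K * (φ k).rOut := by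
    refine (φ k).dist_normed_convolution_le hu.continuous.aestronglyMeasurable fun y hy => ?_
    refine (hu.dist_le_mul y x).trans ?_
    gcongr
    exact (Metric.mem_ball.1 hy).le
  have lim (x) : Tendsto (fun k => v k x) atTop (𝓝 (u x)) := by
    rw [tendsto_iff_dist_tendsto_zero]
    exact squeeze_zero (fun _ => dist_nonneg) (fun k => near k x)
      (by simpa using hφ.const_mul (K : ℝ))
  have lim' : ∀ᵐ x, Tendsto (fun k => fderiv ℝ (v k) x) atTop (𝓝 (fderiv ℝ u x)) := by
    have hloc : LocallyIntegrable (fderiv ℝ u) :=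
      (memLp_top_of_bound (measurable_fderiv ℝ u).aestronglyMeasurable K
        (ae_of_all _ fun x => norm_fderiv_le_of_lipschitz ℝ hu)).locallyIntegrable le_top
    have := ContDiffBump.ae_convolution_tendsto_right_of_locallyIntegrable (K := 2) hφ
      (Eventually.of_forall fun k => le_rfl) hloc
    filter_upwards [this] with x hx
    simpa only [hv'] using hx
  obtain ⟨B, hB⟩ := hb.isCompact_closure.exists_bound_of_continuousOn hu.continuous.continuousOn
  have bd (k : ℕ) : ∀ᵐ x ∂volume.restrict Ω, ‖v k x‖ ≤ B + K * 2 := by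
    refine (ae_restrict_iff' hm).2 (ae_of_all _ fun x hx => ?_)
    have h1 := hB x (subset_closure hx)
    have h2 := near k x
    have h3 : (K : ℝ) * (φ k).rOut ≤ K * 2 := mul_le_mul_of_nonneg_left (hφ2 k) K.2
    have h4 := norm_le_norm_add_norm_sub' (v k x) (u x)
    rw [dist_eq_norm] at h2
    linarith
  have t1 : Tendsto (fun k => ∫ x in Ω, v k x) atTop (𝓝 (∫ x in Ω, u x)) :=
    tendsto_integral_of_dominated_convergence (fun _ => B + K * 2)
      (fun k => (hv k).continuous.aestronglyMeasurable) (integrable_const _) bd (ae_of_all _ lim)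
  have t2 : Tendsto (fun k => ∫ x in Ω, v k x ^ 2) atTop (𝓝 (∫ x in Ω, u x ^ 2)) := by
    refine tendsto_integral_of_dominated_convergence (fun _ => (B + K * 2) ^ 2)
      (fun k => ((hv k).continuous.pow 2).aestronglyMeasurable) (integrable_const _) (fun k => ?_)
      (ae_of_all _ fun x => (lim x).pow 2)
    filter_upwards [bd k] with x hx
    rw [norm_pow]
    gcongr
  have t3 : Tendsto (fun k => ∫ x in Ω, ‖fderiv ℝ (v k) x‖ ^ 2) atTop
      (𝓝 (∫ x in Ω, ‖fderiv ℝ u x‖ ^ 2)) := by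
    refine tendsto_integral_of_dominated_convergence (fun _ => (K : ℝ) ^ 2)
      (fun k => (((hv k).continuous_fderiv one_ne_zero).norm.pow 2).aestronglyMeasurable)
      (integrable_const _) (fun k => ae_of_all _ fun x => ?_) ?_
    · rw [norm_pow, norm_norm, hv']
      gcongr
      exact hu.norm_fderiv_bump_convolution_le (φ k) x
    · filter_upwards [ae_restrict_of_ae lim'] with x hx using hx.norm.pow 2
  have key := le_of_tendsto_of_tendsto' (((t2.const_mul (volume.real Ω)).sub
    (t1.pow 2)).const_mul (κ ^ 2)) (t3.const_mul (volume.real Ω))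
    fun k => variance_poincare_of_contDiff hn ho hb hc (hv k) hκ hκD
  rw [hmean] at key
  refine le_of_mul_le_mul_left ?_ hpos
  linarith

end Lipschitz

/-- **The Payne–Weinberger inequality.** For a bounded open convex set `Ω ⊆ ℝⁿ`
(`n ≥ 2`) and every Lipschitz `u : ℝⁿ → ℝ` with zero mean over `Ω`,
`∫_Ω u² ≤ (diam Ω / π)² ∫_Ω |∇u|²`. -/
theorem payne_weinberger (n : ℕ) (hn : 2 ≤ n)
    (Ω : Set (EuclideanSpace ℝ (Fin n)))
    (ho : IsOpen Ω) (hb : Bornology.IsBounded Ω) (hc : Convex ℝ Ω)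
    (u : EuclideanSpace ℝ (Fin n) → ℝ) (hu : ∃ K, LipschitzWith K u)
    (hmean : (∫ x in Ω, u x) = 0) :
    (∫ x in Ω, u x ^ 2) ≤
      (Metric.diam Ω / π) ^ 2 * ∫ x in Ω, ‖fderiv ℝ u x‖ ^ 2 := by
  obtain ⟨K, hK⟩ := hu
  have hcont : ContinuousAt
      (fun η => ((Metric.diam Ω + η) / π) ^ 2 * ∫ x in Ω, ‖fderiv ℝ u x‖ ^ 2) 0 := by
    fun_prop
  have hlim := hcont.tendsto.mono_left (nhdsWithin_le_nhds (s := Ioi 0))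
  rw [add_zero] at hlim
  refine ge_of_tendsto hlim ?_
  filter_upwards [self_mem_nhdsWithin] with η (hη : 0 < η)
  have hD : 0 < Metric.diam Ω + η := add_pos_of_nonneg_of_pos Metric.diam_nonneg hη
  have key := poincare_of_lipschitz (by omega) ho hb hc hK hmean (div_pos pi_pos hD) <| by
    rw [div_mul_eq_mul_div, div_lt_iff₀ hD]
    exact mul_lt_mul_of_pos_left (by linarith) pi_pos
  calc ∫ x in Ω, u x ^ 2 = ((Metric.diam Ω + η) / π) ^ 2 *
        ((π / (Metric.diam Ω + η)) ^ 2 * ∫ x in Ω, u x ^ 2) := by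
        have := pi_pos.ne'
        field_simp
    _ ≤ _ := mul_le_mul_of_nonneg_left key (sq_nonneg _)
end

section
/- Let a > 0, let Ω ⊂ ℝ² be the open right triangle with vertices (0,0), (a,0) and (0,a), and let G be its hypotenuse, parametrized by t ↦ (t, a−t) for t ∈ (0,a), with arclength element √2 dt. For every continuously differentiable function u on the closed triangle, setting ⟨u⟩_G = (1/a) ∫₀^a u(t, a−t) dt, one has √2 ∫₀^a (u(t, a−t) − ⟨u⟩_G)² dt ≤ (a/√2) ∫_Ω |∇u|² dx, and the constant a/√2 is the smallest constant for which this inequality holds for all such u. -/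
open Real MeasureTheory Set intervalIntegral

/-- The point of the Euclidean plane with coordinates `(x, y)`. -/
noncomputable def pt2 (x y : ℝ) : EuclideanSpace ℝ (Fin 2) :=
  (WithLp.equiv 2 (Fin 2 → ℝ)).symm ![x, y]

/-- The open right triangle with vertices `(0,0)`, `(a,0)` and `(0,a)`. -/
def openTriangle (a : ℝ) : Set (EuclideanSpace ℝ (Fin 2)) :=
  {x | 0 < x 0 ∧ 0 < x 1 ∧ x 0 + x 1 < a}

/-- The closed right triangle with vertices `(0,0)`, `(a,0)` and `(0,a)`. -/
def closedTriangle (a : ℝ) : Set (EuclideanSpace ℝ (Fin 2)) :=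
  {x | 0 ≤ x 0 ∧ 0 ≤ x 1 ∧ x 0 + x 1 ≤ a}

theorem Measurable.intervalIntegrable_of_abs_le {f : ℝ → ℝ} {M : ℝ} (hf : Measurable f)
    (hM : ∀ x, |f x| ≤ M) (b c : ℝ) : IntervalIntegrable f volume b c := by
  refine (intervalIntegrable_const (c := M)).mono_fun hf.aestronglyMeasurable ?_
  exact Filter.Eventually.of_forall fun x => (hM x).trans (le_abs_self M)

theorem sq_intervalIntegral_le {f : ℝ → ℝ} {b c : ℝ} (hbc : b ≤ c)
    (hf : IntervalIntegrable f volume b c)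
    (hf2 : IntervalIntegrable (fun x => f x ^ 2) volume b c) :
    (∫ x in b..c, f x) ^ 2 ≤ (c - b) * ∫ x in b..c, f x ^ 2 := by
  rcases hbc.eq_or_lt with rfl | hlt
  · simp
  set m := ∫ x in b..c, f x with hm
  have h0 : 0 ≤ ∫ x in b..c, ((c - b) * f x - m) ^ 2 :=
    integral_nonneg hbc fun x _ => sq_nonneg _
  have h1 : ∫ x in b..c, ((c - b) * f x - m) ^ 2 =
      (c - b) * ((c - b) * ∫ x in b..c, f x ^ 2) - (c - b) * m ^ 2 := by
    have : ∀ x, ((c - b) * f x - m) ^ 2 =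
        ((c - b) ^ 2 * f x ^ 2 - 2 * (c - b) * m * f x) + m ^ 2 := fun x => by ring
    simp_rw [this]
    rw [integral_add ((hf2.const_mul _).sub (hf.const_mul _)) intervalIntegrable_const,
      integral_sub (hf2.const_mul _) (hf.const_mul _), intervalIntegral.integral_const_mul,
      intervalIntegral.integral_const_mul, intervalIntegral.integral_const, ← hm, smul_eq_mul]
    ring
  rw [h1, ← mul_sub] at h0
  linarith [nonneg_of_mul_nonneg_right h0 (sub_pos.2 hlt)]

theorem intervalIntegral_symm_eq {f : ℝ → ℝ} {a : ℝ}
    (hf : IntervalIntegrable f volume (-a) 0) (hf' : IntervalIntegrable f volume 0 a) :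
    ∫ x in -a..a, f x = ∫ x in (0 : ℝ)..a, (f x + f (-x)) := by
  have h : IntervalIntegrable (fun x => f (-x)) volume 0 a := by
    simpa using (hf.comp_sub_left 0).symm
  rw [integral_add hf' h, integral_comp_neg, neg_zero, ← integral_add_adjacent_intervals hf hf']
  ring

/-- Energy bound along a path on `[-a, a]`, separating the odd and even parts. -/
theorem path_energy_bound {a M : ℝ} (ha : 0 < a) {γ r : ℝ → ℝ} (hγ : Continuous γ)
    (hr : Measurable r) (hM : ∀ x, |r x| ≤ M)
    (hFTC : ∀ x y, -a ≤ x → x ≤ y → y ≤ a → ∫ z in x..y, r z = γ y - γ x) :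
    a * ((γ a - γ (-a)) / 2) ^ 2 +
      ∫ s in -a..a, ((γ a + γ (-a)) / 2 - (γ s + γ (-s)) / 2) ^ 2 ≤
    a ^ 2 / 2 * ∫ x in -a..a, r x ^ 2 := by
  have hrn : Measurable fun x => r (-x) := hr.comp measurable_neg
  have hI := hr.intervalIntegrable_of_abs_le hM
  have hIn := hrn.intervalIntegrable_of_abs_le (fun x => hM (-x))
  have sqb : ∀ f : ℝ → ℝ, Measurable f → (∀ x, |f x| ≤ 2 * M) → ∀ b c,
      IntervalIntegrable (fun x => f x ^ 2) volume b c := fun f hf hfM =>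
    (hf.pow_const 2).intervalIntegrable_of_abs_le (M := (2 * M) ^ 2) fun x => by
      rw [abs_pow]; exact pow_le_pow_left₀ (abs_nonneg _) (hfM x) 2
  have hM0 : 0 ≤ M := (abs_nonneg _).trans (hM 0)
  have hm2 := sqb _ (hr.sub hrn) fun x => by
    have := abs_sub (r x) (r (-x)); simp only [Pi.sub_apply]; linarith [hM x, hM (-x)]
  have hp2 := sqb _ (hr.add hrn) fun x => by
    have := abs_add_le (r x) (r (-x)); simp only [Pi.add_apply]; linarith [hM x, hM (-x)]
  have hr2 := sqb _ hr fun x => by linarith [hM x]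
  simp only [Pi.sub_apply, Pi.add_apply] at hm2 hp2
  have hneg : ∀ s, 0 ≤ s → s ≤ a → ∫ x in s..a, r (-x) = γ (-s) - γ (-a) := fun s h0 h1 => by
    rw [integral_comp_neg, hFTC _ _ le_rfl (by linarith) (by linarith)]
  have hpos : ∀ s, 0 ≤ s → s ≤ a → ∫ x in s..a, r x = γ a - γ s := fun s h0 h1 =>
    hFTC _ _ (by linarith) h1 le_rfl
  set Bm := ∫ x in (0 : ℝ)..a, (r x - r (-x)) ^ 2 with hBm
  set Bp := ∫ x in (0 : ℝ)..a, (r x + r (-x)) ^ 2 with hBp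
  have hsum : Bm + Bp = 2 * ∫ x in -a..a, r x ^ 2 := by
    rw [intervalIntegral_symm_eq (hr2 _ _) (hr2 _ _), ← intervalIntegral.integral_const_mul,
      hBm, hBp,
      ← integral_add (hm2 _ _) (hp2 _ _)]
    congr 1; ext x; ring
  have hodd : ((γ a - γ (-a)) / 2) ^ 2 ≤ a / 4 * Bp := by
    have h := sq_intervalIntegral_le ha.le ((hI 0 a).add (hIn 0 a)) (hp2 0 a)
    rw [integral_add (hI _ _) (hIn _ _), hneg 0 le_rfl ha.le, hpos 0 le_rfl ha.le] at h
    simp only [neg_zero, sub_zero] at h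
    rw [← hBp] at h
    nlinarith
  have heven : ∀ s ∈ Icc 0 a,
      ((γ a + γ (-a)) / 2 - (γ s + γ (-s)) / 2) ^ 2 ≤ (a - s) * (Bm / 4) := by
    rintro s ⟨h0, h1⟩
    have h := sq_intervalIntegral_le h1 ((hI s a).sub (hIn s a)) (hm2 s a)
    rw [integral_sub (hI _ _) (hIn _ _), hneg s h0 h1, hpos s h0 h1] at h
    have hle : ∫ x in s..a, (r x - r (-x)) ^ 2 ≤ Bm := by
      rw [hBm]
      exact integral_mono_interval h0 h1 le_rfl
        (Filter.Eventually.of_forall fun x => sq_nonneg _) (hm2 _ _)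
    have := mul_le_mul_of_nonneg_left hle (sub_nonneg.2 h1)
    nlinarith
  have hc : Continuous fun s => ((γ a + γ (-a)) / 2 - (γ s + γ (-s)) / 2) ^ 2 := by fun_prop
  have hint : ∫ s in -a..a, ((γ a + γ (-a)) / 2 - (γ s + γ (-s)) / 2) ^ 2 ≤ a ^ 2 / 4 * Bm := by
    rw [intervalIntegral_symm_eq (hc.intervalIntegrable _ _) (hc.intervalIntegrable _ _)]
    have h1 : ∫ s in (0 : ℝ)..a, (((γ a + γ (-a)) / 2 - (γ s + γ (-s)) / 2) ^ 2 +
        ((γ a + γ (-a)) / 2 - (γ (-s) + γ (- -s)) / 2) ^ 2) ≤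
        ∫ s in (0 : ℝ)..a, (a - s) * (Bm / 2) := by
      refine integral_mono_on ha.le (by apply Continuous.intervalIntegrable; fun_prop)
        (by apply Continuous.intervalIntegrable; fun_prop) fun s hs => ?_
      have := heven s hs
      rw [neg_neg, add_comm (γ (-s))]
      linarith
    have h2 : ∫ s in (0 : ℝ)..a, (a - s) * (Bm / 2) = a ^ 2 / 4 * Bm := by
      rw [intervalIntegral.integral_mul_const, integral_sub intervalIntegrable_const (by simp)]
      simp; ring
    linarith
  have := mul_le_mul_of_nonneg_left hodd ha.le
  nlinarith

/-- A symmetric kernel cannot approximate a function of one variable better than its mean. -/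
theorem variance_le_of_symm_kernel {μ : Measure ℝ} [IsFiniteMeasure μ] {g : ℝ → ℝ}
    {w : ℝ × ℝ → ℝ} (c : ℝ) (hc : ∫ x, g x ∂μ = c * μ.real univ) (hw : ∀ z, w z.swap = w z)
    (hg : Integrable g μ) (hg2 : Integrable (fun x => (g x - c) ^ 2) μ)
    (hgw : Integrable (fun z : ℝ × ℝ => (g z.1 - w z) ^ 2) (μ.prod μ)) :
    μ.real univ / 2 * ∫ x, (g x - c) ^ 2 ∂μ ≤ ∫ z, (g z.1 - w z) ^ 2 ∂μ.prod μ := by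
  set f : ℝ → ℝ := fun x => g x - c with hf
  have hfi : Integrable f μ := hg.sub (integrable_const c)
  have hf0 : ∫ x, f x ∂μ = 0 := by
    rw [hf, integral_sub hg (integrable_const c), hc, MeasureTheory.integral_const, smul_eq_mul]; ring
  have hswapi : Integrable (fun z : ℝ × ℝ => (g z.2 - w z) ^ 2) (μ.prod μ) := by
    refine hgw.swap.congr (Filter.Eventually.of_forall fun z => ?_)
    simp [hw]
  have hswap : ∫ z : ℝ × ℝ, (g z.2 - w z) ^ 2 ∂μ.prod μ = ∫ z, (g z.1 - w z) ^ 2 ∂μ.prod μ := by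
    rw [← integral_prod_swap]
    simp [hw]
  have h1 : Integrable (fun z : ℝ × ℝ => f z.1 ^ 2) (μ.prod μ) := hg2.comp_fst μ
  have h2 : Integrable (fun z : ℝ × ℝ => f z.2 ^ 2) (μ.prod μ) := hg2.comp_snd μ
  have h12 : Integrable (fun z : ℝ × ℝ => f z.1 ^ 2 + f z.2 ^ 2) (μ.prod μ) := h1.add h2
  have h3 : Integrable (fun z : ℝ × ℝ => f z.1 * f z.2) (μ.prod μ) := hfi.mul_prod hfi
  have hle : ∫ z : ℝ × ℝ, ((f z.1 ^ 2 + f z.2 ^ 2) - 2 * (f z.1 * f z.2)) ∂μ.prod μ ≤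
      ∫ z : ℝ × ℝ, 2 * ((g z.1 - w z) ^ 2 + (g z.2 - w z) ^ 2) ∂μ.prod μ := by
    refine integral_mono (h12.sub (h3.const_mul 2)) ((hgw.add hswapi).const_mul 2)
      fun z => ?_
    simp only [hf]
    nlinarith [sq_nonneg (g z.1 - w z + (g z.2 - w z))]
  rw [MeasureTheory.integral_sub h12 (h3.const_mul 2), MeasureTheory.integral_add h1 h2,
    MeasureTheory.integral_const_mul, MeasureTheory.integral_const_mul,
    MeasureTheory.integral_add hgw hswapi, hswap, integral_prod_mul, hf0,
    integral_fun_fst (fun x => f x ^ 2), integral_fun_snd (fun x => f x ^ 2)] at hle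
  simp only [smul_eq_mul, mul_zero, sub_zero] at hle
  linarith

theorem pt2_apply_zero (x y : ℝ) : pt2 x y 0 = x := rfl

theorem pt2_apply_one (x y : ℝ) : pt2 x y 1 = y := rfl

theorem pt2_eq (x y : ℝ) : pt2 x y =
    x • EuclideanSpace.single (0 : Fin 2) (1 : ℝ) + y • EuclideanSpace.single (1 : Fin 2) (1 : ℝ) := by
  ext i
  fin_cases i <;> simp [pt2]

theorem continuous_pt2 : Continuous fun z : ℝ × ℝ => pt2 z.1 z.2 := by
  simp_rw [pt2_eq]
  fun_prop

theorem pt2_mem_openTriangle {a x y : ℝ} :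
    pt2 x y ∈ openTriangle a ↔ 0 < x ∧ 0 < y ∧ x + y < a := Iff.rfl

theorem pt2_mem_closedTriangle {a x y : ℝ} :
    pt2 x y ∈ closedTriangle a ↔ 0 ≤ x ∧ 0 ≤ y ∧ x + y ≤ a := Iff.rfl

theorem isOpen_openTriangle (a : ℝ) : IsOpen (openTriangle a) := by
  have h0 : Continuous fun x : EuclideanSpace ℝ (Fin 2) => x 0 := by fun_prop
  have h1 : Continuous fun x : EuclideanSpace ℝ (Fin 2) => x 1 := by fun_prop
  exact (isOpen_lt continuous_const h0).inter
    ((isOpen_lt continuous_const h1).inter (isOpen_lt (h0.add h1) continuous_const))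

theorem setIntegral_openTriangle (a : ℝ) (h : EuclideanSpace ℝ (Fin 2) → ℝ) :
    ∫ x in openTriangle a, h x =
      ∫ z : ℝ × ℝ, (openTriangle a).indicator h (pt2 z.1 z.2) := by
  have hmp := (EuclideanSpace.volume_preserving_symm_measurableEquiv_toLp (Fin 2)).symm.comp
    ((volume_preserving_finTwoArrow ℝ).symm)
  rw [← MeasureTheory.integral_indicator (isOpen_openTriangle a).measurableSet]
  have := hmp.integral_comp ((MeasurableEquiv.finTwoArrow.symm.trans
    (MeasurableEquiv.toLp 2 (Fin 2 → ℝ))).measurableEmbedding) ((openTriangle a).indicator h)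
  rw [← this]
  rfl

theorem norm_sq_clm_eq (L : EuclideanSpace ℝ (Fin 2) →L[ℝ] ℝ) :
    ‖L‖ ^ 2 = L (EuclideanSpace.single 0 1) ^ 2 + L (EuclideanSpace.single 1 1) ^ 2 := by
  set v := (InnerProductSpace.toDual ℝ (EuclideanSpace ℝ (Fin 2))).symm L with hv
  have h : ∀ x, L x = inner ℝ v x := fun x => by simp [hv]
  have hn : ‖L‖ = ‖v‖ := by simp [hv]
  rw [hn, EuclideanSpace.norm_sq_eq, Fin.sum_univ_two, h, h]
  simp [EuclideanSpace.inner_single_right]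

theorem integrable_of_abs_le_of_support {f : ℝ × ℝ → ℝ} {M A : ℝ} (hf : Measurable f)
    (hM : ∀ z, |f z| ≤ M) (hA : ∀ z, f z ≠ 0 → |z.1| ≤ A ∧ |z.2| ≤ A) : Integrable f := by
  have hs : Function.support f ⊆ Icc (-A) A ×ˢ Icc (-A) A := fun z hz =>
    ⟨abs_le.1 (hA z hz).1, abs_le.1 (hA z hz).2⟩
  rw [← integrableOn_iff_integrable_of_support_subset hs]
  refine Measure.integrableOn_of_bounded (M := M) ?_ hf.aestronglyMeasurable
    (Filter.Eventually.of_forall hM)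
  exact (isCompact_Icc.prod isCompact_Icc).measure_lt_top.ne

theorem integral_comp_abs_div_two {h : ℝ → ℝ} (h0 : ∀ x, x ≤ 0 → h x = 0) :
    ∫ v, h (|v| / 2) = 4 * ∫ x, h x := by
  have h1 : ∫ x in Ioi (0 : ℝ), h (x / 2) = ∫ x, h (x / 2) :=
    setIntegral_eq_integral_of_forall_compl_eq_zero fun x hx =>
      h0 _ (by simp only [mem_Ioi, not_lt] at hx; linarith)
  rw [integral_comp_abs (f := fun x => h (x / 2)), h1, Measure.integral_comp_div]
  simp; ring

/-- The map `(ξ, η) ↦ (|ξ + η| / 2, |ξ - η| / 2)` folds the square `[-a, a]²` four to one onto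
the triangle, with Jacobian `1 / 2`. -/
theorem integral_fold {a M : ℝ} {H : ℝ × ℝ → ℝ} (hH : Measurable H) (hM : ∀ z, |H z| ≤ M)
    (hs : ∀ z, H z ≠ 0 → 0 < z.1 ∧ 0 < z.2 ∧ z.1 + z.2 < a) :
    ∫ z : ℝ × ℝ, H (|z.1 + z.2| / 2, |z.1 - z.2| / 2) = 8 * ∫ z, H z := by
  have hHi : Integrable H := integrable_of_abs_le_of_support (A := a) hH hM fun z hz => by
    obtain ⟨h1, h2, h3⟩ := hs z hz
    rw [abs_of_pos h1, abs_of_pos h2]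
    constructor <;> linarith
  have hs1 : ∀ v w, H (|v| / 2, |w| / 2) ≠ 0 → |v| ≤ 2 * a ∧ |w| ≤ 2 * a := fun v w h => by
    obtain ⟨h1, h2, h3⟩ := hs _ h
    simp only at h1 h2 h3
    constructor <;> linarith
  have i1 : Integrable (fun z : ℝ × ℝ => H (|z.1 + z.2| / 2, |z.1 - z.2| / 2)) := by
    refine integrable_of_abs_le_of_support (A := 2 * a) (hH.comp (by fun_prop))
      (fun z => hM _) fun z hz => ?_
    obtain ⟨h1, h2⟩ := hs1 _ _ hz
    rw [abs_le] at *
    rw [abs_le]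
    constructor <;> constructor <;> linarith
  have i2 : Integrable (fun z : ℝ × ℝ => H (|z.2| / 2, |z.2 - 2 * z.1| / 2)) := by
    refine integrable_of_abs_le_of_support (A := 2 * a) (hH.comp (by fun_prop))
      (fun z => hM _) fun z hz => ?_
    obtain ⟨h1, h2⟩ := hs1 _ _ hz
    rw [abs_le] at *
    rw [abs_le]
    constructor <;> constructor <;> linarith
  calc ∫ z : ℝ × ℝ, H (|z.1 + z.2| / 2, |z.1 - z.2| / 2)
      = ∫ t : ℝ, ∫ ξ : ℝ, H (|ξ + t| / 2, |ξ - t| / 2) := integral_prod_symm _ i1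
    _ = ∫ t : ℝ, ∫ v : ℝ, H (|v| / 2, |v - 2 * t| / 2) := by
        congr 1; ext t
        rw [← integral_add_right_eq_self (fun v => H (|v| / 2, |v - 2 * t| / 2)) t]
        congr 1; ext ξ
        congr 4; ring
    _ = ∫ v : ℝ, ∫ t : ℝ, H (|v| / 2, |v - 2 * t| / 2) := integral_integral_swap i2
    _ = ∫ v : ℝ, 2⁻¹ * ∫ w : ℝ, H (|v| / 2, |w| / 2) := by
        congr 1; ext v
        have h := Measure.integral_comp_mul_left (fun s => H (|v| / 2, |v - s| / 2)) 2
        rw [h, integral_sub_left_eq_self (fun w => H (|v| / 2, |w| / 2)) volume v]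
        simp
    _ = ∫ v : ℝ, 2 * ∫ w : ℝ, H (|v| / 2, w) := by
        congr 1; ext v
        rw [integral_comp_abs_div_two (h := fun w => H (|v| / 2, w))]
        · ring
        · intro x hx
          by_contra h
          exact absurd (hs _ h).2.1 (not_lt.2 hx)
    _ = 8 * ∫ z, H z := by
        rw [MeasureTheory.integral_const_mul,
          integral_comp_abs_div_two (h := fun v => ∫ w : ℝ, H (v, w)), Measure.volume_eq_prod,
          integral_prod _ hHi]
        · ring
        · intro x hx
          have : ∀ w, H (x, w) = 0 := fun w => by
            by_contra h
            exact absurd (hs _ h).1 (not_lt.2 hx)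
          simp [this]

/-- The fold of the square `[-a, a]²` onto the closed triangle. -/
noncomputable def squareFold (ξ t : ℝ) : EuclideanSpace ℝ (Fin 2) := pt2 (|ξ + t| / 2) (|ξ - t| / 2)

theorem continuous_squareFold : Continuous fun z : ℝ × ℝ => squareFold z.1 z.2 :=
  continuous_pt2.comp (by fun_prop :
    Continuous fun z : ℝ × ℝ => (|z.1 + z.2| / 2, |z.1 - z.2| / 2))

theorem squareFold_swap (ξ t : ℝ) : squareFold t ξ = squareFold ξ t := by
  simp [squareFold, add_comm t, abs_sub_comm t]

theorem squareFold_neg_left (ξ t : ℝ) : squareFold (-ξ) t = squareFold ξ (-t) := by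
  rw [squareFold, squareFold, ← abs_neg (-ξ + t), ← abs_neg (-ξ - t)]
  congr 3 <;> ring

theorem squareFold_mem_openTriangle {a ξ t : ℝ} (hξ : |ξ| < a) (ht : |t| < a)
    (h1 : ξ + t ≠ 0) (h2 : ξ - t ≠ 0) : squareFold ξ t ∈ openTriangle a := by
  refine pt2_mem_openTriangle.2 ⟨by positivity, by positivity, ?_⟩
  rw [abs_lt] at hξ ht
  rcases abs_cases (ξ + t) with h | h <;> rcases abs_cases (ξ - t) with h' | h' <;> linarith

theorem abs_lt_of_squareFold_mem {a ξ t : ℝ} (h : squareFold ξ t ∈ openTriangle a) :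
    |ξ| < a ∧ |t| < a ∧ 0 < |ξ + t| ∧ 0 < |ξ - t| := by
  obtain ⟨h1, h2, h3⟩ := pt2_mem_openTriangle.1 h
  refine ⟨?_, ?_, by linarith, by linarith⟩ <;> rw [abs_lt] <;> constructor <;>
    linarith [neg_abs_le (ξ + t), le_abs_self (ξ + t), neg_abs_le (ξ - t), le_abs_self (ξ - t)]

/-- A two-valued sign function, equal to `-1` at `0`. -/
noncomputable def twoSign (x : ℝ) : ℝ := if 0 < x then 1 else -1

theorem measurable_twoSign : Measurable twoSign :=
  Measurable.ite measurableSet_Ioi measurable_const measurable_const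

theorem twoSign_sq (x : ℝ) : twoSign x ^ 2 = 1 := by
  unfold twoSign; split_ifs <;> norm_num

theorem abs_twoSign (x : ℝ) : |twoSign x| = 1 := by
  unfold twoSign; split_ifs <;> norm_num

theorem twoSign_neg {x : ℝ} (hx : x ≠ 0) : twoSign (-x) = -twoSign x := by
  unfold twoSign
  rcases hx.lt_or_gt with h | h
  · simp [h, h.not_gt]
  · simp [h, h.le]

theorem hasDerivAt_abs_twoSign {x : ℝ} (hx : x ≠ 0) : HasDerivAt (fun x => |x|) (twoSign x) x := by
  unfold twoSign
  split_ifs with h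
  · exact hasDerivAt_abs_pos h
  · exact hasDerivAt_abs_neg (lt_of_le_of_ne (not_lt.1 h) hx)

/-- The partial derivatives of `v` on the open triangle, extended by zero. -/
noncomputable def trianglePartial (a : ℝ) (v : EuclideanSpace ℝ (Fin 2) → ℝ) (i : Fin 2) :
    EuclideanSpace ℝ (Fin 2) → ℝ :=
  (openTriangle a).indicator fun x => fderiv ℝ v x (EuclideanSpace.single i 1)

theorem measurable_trianglePartial (a : ℝ) (v : EuclideanSpace ℝ (Fin 2) → ℝ) (i : Fin 2) :
    Measurable (trianglePartial a v i) :=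
  (measurable_fderiv_apply_const ℝ v _).indicator (isOpen_openTriangle a).measurableSet

theorem abs_trianglePartial_le {a M : ℝ} {v : EuclideanSpace ℝ (Fin 2) → ℝ} (hM0 : 0 ≤ M)
    (hM : ∀ x ∈ openTriangle a, ‖fderiv ℝ v x‖ ≤ M) (i : Fin 2) (x : EuclideanSpace ℝ (Fin 2)) :
    |trianglePartial a v i x| ≤ M := by
  unfold trianglePartial indicator
  split_ifs with h
  · have := (fderiv ℝ v x).le_opNorm (EuclideanSpace.single i 1)
    simp only [PiLp.norm_single, norm_one, mul_one] at this
    exact this.trans (hM x h)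
  · simpa using hM0

/-- The first partial derivative of `v` composed with the fold. -/
noncomputable def foldSlope (a : ℝ) (v : EuclideanSpace ℝ (Fin 2) → ℝ) (ξ t : ℝ) : ℝ :=
  (twoSign (ξ + t) * trianglePartial a v 0 (squareFold ξ t) +
    twoSign (ξ - t) * trianglePartial a v 1 (squareFold ξ t)) / 2

theorem measurable_foldSlope (a : ℝ) (v : EuclideanSpace ℝ (Fin 2) → ℝ) :
    Measurable fun z : ℝ × ℝ => foldSlope a v z.1 z.2 := by
  have h := fun i => (measurable_trianglePartial a v i).comp continuous_squareFold.measurable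
  have h1 : Measurable fun z : ℝ × ℝ => twoSign (z.1 + z.2) := measurable_twoSign.comp (by fun_prop)
  have h2 : Measurable fun z : ℝ × ℝ => twoSign (z.1 - z.2) := measurable_twoSign.comp (by fun_prop)
  exact ((h1.mul (h 0)).add (h2.mul (h 1))).div_const 2

theorem abs_foldSlope_le {a M : ℝ} {v : EuclideanSpace ℝ (Fin 2) → ℝ} (hM0 : 0 ≤ M)
    (hM : ∀ x ∈ openTriangle a, ‖fderiv ℝ v x‖ ≤ M) (ξ t : ℝ) : |foldSlope a v ξ t| ≤ M := by
  have h := abs_add_le (twoSign (ξ + t) * trianglePartial a v 0 (squareFold ξ t))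
    (twoSign (ξ - t) * trianglePartial a v 1 (squareFold ξ t))
  rw [abs_mul, abs_mul, abs_twoSign, abs_twoSign] at h
  rw [foldSlope, abs_div, abs_two]
  linarith [abs_trianglePartial_le hM0 hM 0 (squareFold ξ t),
    abs_trianglePartial_le hM0 hM 1 (squareFold ξ t)]

theorem abs_lt_of_foldSlope_ne_zero {a ξ t : ℝ} {v : EuclideanSpace ℝ (Fin 2) → ℝ}
    (h : foldSlope a v ξ t ≠ 0) : |ξ| < a ∧ |t| < a := by
  have hmem : squareFold ξ t ∈ openTriangle a := by
    by_contra hn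
    exact h (by simp [foldSlope, trianglePartial, hn])
  exact ⟨(abs_lt_of_squareFold_mem hmem).1, (abs_lt_of_squareFold_mem hmem).2.1⟩

theorem integrable_foldSlope_sq {a M : ℝ} {v : EuclideanSpace ℝ (Fin 2) → ℝ} (hM0 : 0 ≤ M)
    (hM : ∀ x ∈ openTriangle a, ‖fderiv ℝ v x‖ ≤ M) :
    Integrable fun z : ℝ × ℝ => foldSlope a v z.1 z.2 ^ 2 := by
  refine integrable_of_abs_le_of_support (M := M ^ 2) (A := a)
    ((measurable_foldSlope a v).pow_const 2) (fun z => ?_) fun z hz => ?_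
  · rw [abs_pow]
    exact pow_le_pow_left₀ (abs_nonneg _) (abs_foldSlope_le hM0 hM _ _) 2
  · have := abs_lt_of_foldSlope_ne_zero (a := a) (v := v) (ξ := z.1) (t := z.2)
      fun h => hz (by simp [h])
    exact ⟨this.1.le, this.2.le⟩

theorem hasDerivAt_comp_squareFold {a ξ t : ℝ} {v : EuclideanSpace ℝ (Fin 2) → ℝ}
    (hv : DifferentiableOn ℝ v (openTriangle a)) (hξ : |ξ| < a) (ht : |t| < a)
    (h1 : ξ + t ≠ 0) (h2 : ξ - t ≠ 0) :
    HasDerivAt (fun ξ => v (squareFold ξ t)) (foldSlope a v ξ t) ξ := by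
  have hmem := squareFold_mem_openTriangle hξ ht h1 h2
  have hvd := (hv.differentiableAt ((isOpen_openTriangle a).mem_nhds hmem)).hasFDerivAt
  have d1 : HasDerivAt (fun ξ => |ξ + t| / 2) (twoSign (ξ + t) / 2) ξ := by
    have := ((hasDerivAt_abs_twoSign h1).comp ξ ((hasDerivAt_id ξ).add_const t)).div_const 2
    simpa using this
  have d2 : HasDerivAt (fun ξ => |ξ - t| / 2) (twoSign (ξ - t) / 2) ξ := by
    have := ((hasDerivAt_abs_twoSign h2).comp ξ ((hasDerivAt_id ξ).sub_const t)).div_const 2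
    simpa using this
  have d3 : HasDerivAt (fun ξ => squareFold ξ t)
      ((twoSign (ξ + t) / 2) • EuclideanSpace.single (0 : Fin 2) (1 : ℝ) +
        (twoSign (ξ - t) / 2) • EuclideanSpace.single (1 : Fin 2) (1 : ℝ)) ξ := by
    simp_rw [squareFold, pt2_eq]
    exact (d1.smul_const _).add (d2.smul_const _)
  refine (hvd.comp_hasDerivAt ξ d3).congr_deriv ?_
  simp only [foldSlope, trianglePartial, indicator_of_mem hmem, map_add, map_smul, smul_eq_mul]
  ring

theorem intervalIntegral_foldSlope {a M t : ℝ} {v : EuclideanSpace ℝ (Fin 2) → ℝ}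
    (hvc : Continuous v) (hv : DifferentiableOn ℝ v (openTriangle a)) (hM0 : 0 ≤ M)
    (hM : ∀ x ∈ openTriangle a, ‖fderiv ℝ v x‖ ≤ M) (ht : |t| < a) (x y : ℝ) (hx : -a ≤ x)
    (hxy : x ≤ y) (hy : y ≤ a) :
    ∫ ξ in x..y, foldSlope a v ξ t = v (squareFold y t) - v (squareFold x t) := by
  have hc : Continuous fun ξ => v (squareFold ξ t) :=
    hvc.comp (continuous_squareFold.comp (by fun_prop : Continuous fun ξ : ℝ => (ξ, t)))
  refine MeasureTheory.integral_eq_of_hasDerivAt_off_countable_of_le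
    (fun ξ => v (squareFold ξ t)) (fun ξ => foldSlope a v ξ t) hxy (s := {t, -t})
    ((countable_singleton _).insert _) hc.continuousOn (fun ξ hξ => ?_) ?_
  · simp only [mem_sdiff, mem_Ioo, mem_insert_iff, mem_singleton_iff, not_or] at hξ
    refine hasDerivAt_comp_squareFold hv (abs_lt.2 ⟨by linarith, by linarith⟩) ht
      (fun h => hξ.2.2 (by linarith)) (fun h => hξ.2.1 (by linarith))
  · exact ((measurable_foldSlope a v).comp (by fun_prop : Measurable fun ξ : ℝ => (ξ, t))
      ).intervalIntegrable_of_abs_le (fun ξ => abs_foldSlope_le hM0 hM ξ t) _ _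

theorem integral_foldSlope_sq {a M : ℝ} {v : EuclideanSpace ℝ (Fin 2) → ℝ} (hM0 : 0 ≤ M)
    (hM : ∀ x ∈ openTriangle a, ‖fderiv ℝ v x‖ ≤ M) :
    ∫ z : ℝ × ℝ, foldSlope a v z.1 z.2 ^ 2 = 2 * ∫ x in openTriangle a, ‖fderiv ℝ v x‖ ^ 2 := by
  set H : ℝ × ℝ → ℝ := fun z =>
    (openTriangle a).indicator (fun x => ‖fderiv ℝ v x‖ ^ 2) (pt2 z.1 z.2) with hHdef
  have hH : Measurable H := (((measurable_fderiv ℝ v).norm.pow_const 2).indicator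
    (isOpen_openTriangle a).measurableSet).comp continuous_pt2.measurable
  have hHM : ∀ z, |H z| ≤ M ^ 2 := fun z => by
    simp only [hHdef, indicator]
    split_ifs with h
    · rw [abs_pow, abs_norm]
      exact pow_le_pow_left₀ (norm_nonneg _) (hM _ h) 2
    · simpa using sq_nonneg M
  have hHs : ∀ z, H z ≠ 0 → 0 < z.1 ∧ 0 < z.2 ∧ z.1 + z.2 < a := fun z hz =>
    pt2_mem_openTriangle.1 (mem_of_indicator_ne_zero hz)
  have hpt : ∀ z : ℝ × ℝ, foldSlope a v z.1 z.2 ^ 2 + foldSlope a v z.swap.1 z.swap.2 ^ 2 =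
      2⁻¹ * H (|z.1 + z.2| / 2, |z.1 - z.2| / 2) := fun z => by
    by_cases hmem : squareFold z.1 z.2 ∈ openTriangle a
    · have hne := (abs_pos.1 (abs_lt_of_squareFold_mem hmem).2.2.2)
      have hHz : H (|z.1 + z.2| / 2, |z.1 - z.2| / 2) = ‖fderiv ℝ v (squareFold z.1 z.2)‖ ^ 2 :=
        indicator_of_mem hmem _
      rw [hHz, norm_sq_clm_eq]
      simp only [foldSlope, Prod.fst_swap, Prod.snd_swap, squareFold_swap z.1 z.2, trianglePartial,
        indicator_of_mem hmem, add_comm z.2 z.1]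
      rw [← neg_sub z.1 z.2, twoSign_neg hne]
      have e1 := twoSign_sq (z.1 + z.2)
      have e2 := twoSign_sq (z.1 - z.2)
      set p := fderiv ℝ v (squareFold z.1 z.2) (EuclideanSpace.single 0 1)
      set q := fderiv ℝ v (squareFold z.1 z.2) (EuclideanSpace.single 1 1)
      linear_combination (p ^ 2 / 2) * e1 + (q ^ 2 / 2) * e2
    · have hHz : H (|z.1 + z.2| / 2, |z.1 - z.2| / 2) = 0 := indicator_of_notMem hmem _
      rw [hHz]
      simp [foldSlope, squareFold_swap z.1 z.2, trianglePartial, hmem]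
  have hi := integrable_foldSlope_sq hM0 hM
  have hsw : ∫ z : ℝ × ℝ, foldSlope a v z.swap.1 z.swap.2 ^ 2 =
      ∫ z : ℝ × ℝ, foldSlope a v z.1 z.2 ^ 2 :=
    integral_prod_swap (μ := volume) (ν := volume) fun z : ℝ × ℝ => foldSlope a v z.1 z.2 ^ 2
  have hsum := MeasureTheory.integral_add hi hi.swap
  simp only [Function.comp_apply] at hsum
  rw [hsw] at hsum
  simp_rw [hpt] at hsum
  rw [MeasureTheory.integral_const_mul, integral_fold hH hHM hHs] at hsum
  rw [setIntegral_openTriangle]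
  linarith

theorem integral_Ioo_eq_intervalIntegral {f : ℝ → ℝ} {b c : ℝ} (h : b ≤ c) :
    ∫ x in Ioo b c, f x = ∫ x in b..c, f x := by
  rw [integral_of_le h, integral_Ioc_eq_integral_Ioo]

theorem Continuous.integrable_restrict_Ioo {f : ℝ → ℝ} (hf : Continuous f) (b c : ℝ) :
    Integrable f (volume.restrict (Ioo b c)) :=
  (hf.integrableOn_Icc (a := b) (b := c)).mono_set Ioo_subset_Icc_self

theorem Continuous.integrable_prod_restrict_Ioo {f : ℝ × ℝ → ℝ} (hf : Continuous f) (b c : ℝ) :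
    Integrable f ((volume.restrict (Ioo b c)).prod (volume.restrict (Ioo b c))) := by
  rw [Measure.prod_restrict]
  exact (hf.continuousOn.integrableOn_compact (isCompact_Icc.prod isCompact_Icc)).mono_set
    (prod_mono (Ioo_subset_Icc_self (a := b) (b := c)) (Ioo_subset_Icc_self (a := b) (b := c)))

theorem symm_trace_bound {a M : ℝ} (ha : 0 < a) {v : EuclideanSpace ℝ (Fin 2) → ℝ}
    (hvc : Continuous v) (hv : DifferentiableOn ℝ v (openTriangle a)) (hM0 : 0 ≤ M)
    (hM : ∀ x ∈ openTriangle a, ‖fderiv ℝ v x‖ ≤ M) (c : ℝ)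
    (hc : ∫ t in -a..a, v (squareFold a t) = c * (2 * a)) :
    ∫ t in -a..a, (v (squareFold a t) - c) ^ 2 ≤
      a * ∫ x in openTriangle a, ‖fderiv ℝ v x‖ ^ 2 := by
  set F : ℝ → ℝ → ℝ := fun s t => v (squareFold s t) with hF
  have hFc : Continuous fun z : ℝ × ℝ => F z.1 z.2 := hvc.comp continuous_squareFold
  have hFu : ∀ s, Continuous (F s) := fun s =>
    hFc.comp (by fun_prop : Continuous fun t : ℝ => (s, t))
  have hFl : ∀ t, Continuous fun s => F s t := fun t =>
    hFc.comp (by fun_prop : Continuous fun s : ℝ => (s, t))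
  have hFneg : ∀ s t, F (-s) t = F s (-t) := fun s t => congrArg v (squareFold_neg_left s t)
  have hFswap : ∀ s t, F t s = F s t := fun s t => congrArg v (squareFold_swap s t)
  set D := ∫ x in openTriangle a, ‖fderiv ℝ v x‖ ^ 2 with hD
  set μ := volume.restrict (Ioo (-a) a) with hμ
  have haa : -a ≤ a := by linarith
  have hμu : μ.real univ = 2 * a := by
    simp only [hμ, measureReal_restrict_apply_univ, Real.volume_real_Ioo_of_le haa]; ring
  set g : ℝ → ℝ := fun t => (F a t + F (-a) t) / 2 with hg
  set o : ℝ → ℝ := fun t => (F a t - F (-a) t) / 2 with ho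
  set w : ℝ × ℝ → ℝ := fun z => (F z.2 z.1 + F (-z.2) z.1) / 2 with hw
  have hgc : Continuous g := ((hFu a).add (hFu (-a))).div_const 2
  have hoc : Continuous o := ((hFu a).sub (hFu (-a))).div_const 2
  have hwc : Continuous w := ((hFc.comp (by fun_prop : Continuous fun z : ℝ × ℝ => (z.2, z.1))).add
    (hFc.comp (by fun_prop : Continuous fun z : ℝ × ℝ => (-z.2, z.1)))).div_const 2
  have hwi : Integrable (fun z : ℝ × ℝ => (g z.1 - w z) ^ 2) (μ.prod μ) :=
    Continuous.integrable_prod_restrict_Ioo (by fun_prop) _ _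
  have hoi : Integrable (fun t => o t ^ 2) μ := (hoc.pow 2).integrable_restrict_Ioo _ _
  have hgci : Integrable (fun t => (g t - c) ^ 2) μ :=
    ((hgc.sub continuous_const).pow 2).integrable_restrict_Ioo _ _
  have hpath : ∀ t ∈ Ioo (-a) a, a * o t ^ 2 + ∫ s, (g t - w (t, s)) ^ 2 ∂μ ≤
      a ^ 2 / 2 * ∫ s, foldSlope a v s t ^ 2 ∂μ := fun t ht => by
    have := path_energy_bound ha (hFl t) (r := fun ξ => foldSlope a v ξ t)
      ((measurable_foldSlope a v).comp (by fun_prop : Measurable fun ξ : ℝ => (ξ, t)))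
      (fun ξ => abs_foldSlope_le hM0 hM ξ t)
      (intervalIntegral_foldSlope hvc hv hM0 hM (abs_lt.2 ht))
    rw [hμ, integral_Ioo_eq_intervalIntegral haa, integral_Ioo_eq_intervalIntegral haa]
    exact this
  have hslope : Integrable (fun z : ℝ × ℝ => foldSlope a v z.1 z.2 ^ 2) (μ.prod μ) := by
    rw [hμ, Measure.prod_restrict]
    exact (integrable_foldSlope_sq hM0 hM).integrableOn
  have henergy : ∫ t, ∫ s, foldSlope a v s t ^ 2 ∂μ ∂μ ≤ 2 * D := by
    rw [← integral_prod_symm _ hslope, hμ, Measure.prod_restrict, hD, ← integral_foldSlope_sq hM0 hM]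
    exact setIntegral_le_integral (integrable_foldSlope_sq hM0 hM)
      (Filter.Eventually.of_forall fun z => sq_nonneg _)
  have hsum : a * ∫ t, o t ^ 2 ∂μ + ∫ z, (g z.1 - w z) ^ 2 ∂μ.prod μ ≤ a ^ 2 * D := by
    rw [integral_prod _ hwi, ← MeasureTheory.integral_const_mul,
      ← MeasureTheory.integral_add (hoi.const_mul a) hwi.integral_prod_left]
    calc _ ≤ ∫ t, a ^ 2 / 2 * ∫ s, foldSlope a v s t ^ 2 ∂μ ∂μ :=
          integral_mono_ae ((hoi.const_mul a).add hwi.integral_prod_left)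
            (hslope.integral_prod_right.const_mul _)
            (ae_restrict_of_forall_mem measurableSet_Ioo hpath)
      _ ≤ a ^ 2 / 2 * (2 * D) := by
          rw [MeasureTheory.integral_const_mul]
          exact mul_le_mul_of_nonneg_left henergy (by positivity)
      _ = a ^ 2 * D := by ring
  have hgmean : ∫ t, g t ∂μ = c * μ.real univ := by
    have h1 : ∫ t in -a..a, F (-a) t = ∫ t in -a..a, F a t := by
      simp_rw [hFneg]
      rw [integral_comp_neg, neg_neg]
    rw [hμu, ← hc, hμ, integral_Ioo_eq_intervalIntegral haa, hg, intervalIntegral.integral_div,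
      integral_add ((hFu _).intervalIntegrable _ _) ((hFu _).intervalIntegrable _ _), h1]
    ring
  have hvar := variance_le_of_symm_kernel c hgmean
    (fun z => by
      simp only [hw, Prod.fst_swap, Prod.snd_swap]
      linarith [hFswap z.2 z.1, hFneg z.2 z.1, hFneg z.1 z.2, hFswap z.1 (-z.2)])
    (hgc.integrable_restrict_Ioo _ _) hgci hwi
  rw [hμu] at hvar
  have hsplit : ∫ t in -a..a, (F a t - c) ^ 2 = ∫ t, o t ^ 2 ∂μ + ∫ t, (g t - c) ^ 2 ∂μ := by
    have hi1 : IntervalIntegrable (fun t => (F a t - c) ^ 2) volume (-a) a :=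
      (((hFu a).sub continuous_const).pow 2).intervalIntegrable _ _
    have hi2 : IntervalIntegrable (fun t => (F a (-t) - c) ^ 2) volume (-a) a :=
      ((((hFu a).comp continuous_neg).sub continuous_const).pow 2).intervalIntegrable _ _
    have h1 : ∫ t in -a..a, (F a (-t) - c) ^ 2 = ∫ t in -a..a, (F a t - c) ^ 2 := by
      rw [integral_comp_neg (fun t => (F a t - c) ^ 2), neg_neg]
    have h2 := integral_add hi1 hi2
    rw [h1] at h2
    rw [← MeasureTheory.integral_add hoi hgci, hμ, integral_Ioo_eq_intervalIntegral haa]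
    have h3 : ∀ t, o t ^ 2 + (g t - c) ^ 2 = ((F a t - c) ^ 2 + (F a (-t) - c) ^ 2) / 2 :=
      fun t => by
        simp only [ho, hg, hFneg]
        ring
    simp_rw [h3]
    rw [intervalIntegral.integral_div, h2]
    ring
  rw [hsplit]
  refine le_of_mul_le_mul_left ?_ ha
  linarith

theorem hypotenuse_bound_of_continuous {a M : ℝ} (ha : 0 < a) {v : EuclideanSpace ℝ (Fin 2) → ℝ}
    (hvc : Continuous v) (hv : DifferentiableOn ℝ v (openTriangle a)) (hM0 : 0 ≤ M)
    (hM : ∀ x ∈ openTriangle a, ‖fderiv ℝ v x‖ ≤ M) :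
    √2 * ∫ t in (0 : ℝ)..a,
        (v (pt2 t (a - t)) - (1 / a) * ∫ s in (0 : ℝ)..a, v (pt2 s (a - s))) ^ 2 ≤
      (a / √2) * ∫ x in openTriangle a, ‖fderiv ℝ v x‖ ^ 2 := by
  have hsub : ∀ f : ℝ → ℝ, ∫ t in (0 : ℝ)..a, f (v (pt2 t (a - t))) =
      2⁻¹ * ∫ t in -a..a, f (v (squareFold a t)) := fun f => by
    have h := integral_comp_mul_sub (a := 0) (b := a) (fun t => f (v (squareFold a t)))
      (two_ne_zero (α := ℝ)) a
    rw [mul_zero, zero_sub, smul_eq_mul, show 2 * a - a = a by ring] at h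
    rw [← h]
    refine integral_congr fun t ht => ?_
    rw [uIcc_of_le ha.le] at ht
    have e : squareFold a (2 * t - a) = pt2 t (a - t) := by
      rw [squareFold, abs_of_nonneg (by linarith [ht.1]), abs_of_nonneg (by linarith [ht.2])]
      congr 1 <;> ring
    simp only [e]
  set c := (1 / a) * ∫ s in (0 : ℝ)..a, v (pt2 s (a - s)) with hcdef
  have hc : ∫ t in -a..a, v (squareFold a t) = c * (2 * a) := by
    have := hsub id
    simp only [id] at this
    rw [hcdef, this]
    field_simp
  have h := symm_trace_bound ha hvc hv hM0 hM c hc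
  rw [hsub fun x => (x - c) ^ 2]
  have h2 : √2 * √2 = 2 := Real.mul_self_sqrt (by norm_num)
  have h2p : 0 < √2 := by positivity
  calc _ ≤ √2 * (2⁻¹ * (a * ∫ x in openTriangle a, ‖fderiv ℝ v x‖ ^ 2)) := by gcongr
    _ = _ := by
      field_simp
      linear_combination (∫ x in openTriangle a, ‖fderiv ℝ v x‖ ^ 2) * h2

theorem openTriangle_subset_closedTriangle (a : ℝ) : openTriangle a ⊆ closedTriangle a :=
  fun _ hx => ⟨hx.1.le, hx.2.1.le, hx.2.2.le⟩

theorem isClosed_closedTriangle (a : ℝ) : IsClosed (closedTriangle a) := by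
  have h0 : Continuous fun x : EuclideanSpace ℝ (Fin 2) => x 0 := by fun_prop
  have h1 : Continuous fun x : EuclideanSpace ℝ (Fin 2) => x 1 := by fun_prop
  exact (isClosed_le continuous_const h0).inter
    ((isClosed_le continuous_const h1).inter (isClosed_le (h0.add h1) continuous_const))

theorem isCompact_closedTriangle (a : ℝ) : IsCompact (closedTriangle a) := by
  refine ((isCompact_Icc (a := (0 : ℝ)) (b := a)).prod (isCompact_Icc (a := (0 : ℝ)) (b := a))
    |>.image continuous_pt2).of_isClosed_subset (isClosed_closedTriangle a) ?_
  rintro x ⟨h0, h1, h2⟩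
  refine ⟨(x 0, x 1), ⟨⟨h0, by dsimp; linarith⟩, ⟨h1, by dsimp; linarith⟩⟩, ?_⟩
  ext i
  fin_cases i <;> rfl

theorem convex_closedTriangle (a : ℝ) : Convex ℝ (closedTriangle a) := by
  rintro x ⟨h0, h1, h2⟩ y ⟨k0, k1, k2⟩ s t hs ht hst
  refine ⟨?_, ?_, ?_⟩ <;> simp only [PiLp.add_apply, PiLp.smul_apply, smul_eq_mul]
  · positivity
  · positivity
  · calc _ = s * (x 0 + x 1) + t * (y 0 + y 1) := by ring
      _ ≤ s * a + t * a := by gcongr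
      _ = a := by rw [← add_mul, hst, one_mul]

theorem uniqueDiffOn_closedTriangle {a : ℝ} (ha : 0 < a) : UniqueDiffOn ℝ (closedTriangle a) := by
  refine uniqueDiffOn_convex (convex_closedTriangle a) ⟨pt2 (a / 3) (a / 3), ?_⟩
  refine interior_maximal (openTriangle_subset_closedTriangle a) (isOpen_openTriangle a) ?_
  exact pt2_mem_openTriangle.2 ⟨by linarith, by linarith, by linarith⟩

theorem exists_norm_fderiv_le {a : ℝ} (ha : 0 < a) {u : EuclideanSpace ℝ (Fin 2) → ℝ}
    (hu : ContDiffOn ℝ 1 u (closedTriangle a)) :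
    ∃ M, 0 ≤ M ∧ ∀ x ∈ openTriangle a, ‖fderiv ℝ u x‖ ≤ M := by
  obtain ⟨M, hM⟩ := (isCompact_closedTriangle a).exists_bound_of_continuousOn
    (hu.continuousOn_fderivWithin (uniqueDiffOn_closedTriangle ha) le_rfl)
  refine ⟨max M 0, le_max_right _ _, fun x hx => ?_⟩
  have hnhds : closedTriangle a ∈ nhds x := Filter.mem_of_superset
    ((isOpen_openTriangle a).mem_nhds hx) (openTriangle_subset_closedTriangle a)
  rw [← fderivWithin_of_mem_nhds hnhds]
  exact (hM x (openTriangle_subset_closedTriangle a hx)).trans (le_max_left _ _)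

theorem hypotenuse_bound {a : ℝ} (ha : 0 < a) {u : EuclideanSpace ℝ (Fin 2) → ℝ}
    (hu : ContDiffOn ℝ 1 u (closedTriangle a)) :
    √2 * ∫ t in (0 : ℝ)..a,
        (u (pt2 t (a - t)) - (1 / a) * ∫ s in (0 : ℝ)..a, u (pt2 s (a - s))) ^ 2 ≤
      (a / √2) * ∫ x in openTriangle a, ‖fderiv ℝ u x‖ ^ 2 := by
  obtain ⟨v, hv⟩ := ContinuousMap.exists_restrict_eq (isClosed_closedTriangle a)
    ⟨(closedTriangle a).domRestrict u, hu.continuousOn.domRestrict⟩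
  have huv : ∀ x ∈ closedTriangle a, v x = u x := fun x hx => DFunLike.congr_fun hv ⟨x, hx⟩
  have hev : ∀ x ∈ openTriangle a, (v : EuclideanSpace ℝ (Fin 2) → ℝ) =ᶠ[nhds x] u := fun x hx =>
    Filter.eventuallyEq_of_mem ((isOpen_openTriangle a).mem_nhds hx) fun y hy =>
      huv y (openTriangle_subset_closedTriangle a hy)
  have hfd : ∀ x ∈ openTriangle a, fderiv ℝ v x = fderiv ℝ u x := fun x hx => (hev x hx).fderiv_eq
  have hvd : DifferentiableOn ℝ v (openTriangle a) :=
    ((hu.differentiableOn one_ne_zero).mono (openTriangle_subset_closedTriangle a)).congr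
      fun x hx => huv x (openTriangle_subset_closedTriangle a hx)
  obtain ⟨M, hM0, hM⟩ := exists_norm_fderiv_le ha hu
  have h := hypotenuse_bound_of_continuous ha v.continuous hvd hM0
    fun x hx => by rw [hfd x hx]; exact hM x hx
  have htrace : ∀ t ∈ uIcc 0 a, v (pt2 t (a - t)) = u (pt2 t (a - t)) := fun t ht => by
    rw [uIcc_of_le ha.le] at ht
    exact huv _ (pt2_mem_closedTriangle.2 ⟨ht.1, by linarith [ht.2], by linarith⟩)
  rw [integral_congr htrace, setIntegral_congr_fun (isOpen_openTriangle a).measurableSet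
    fun x hx => congrArg (‖·‖ ^ 2) (hfd x hx)] at h
  rwa [integral_congr fun t ht => by rw [htrace t ht]] at h

/-- The first sloshing eigenfunction of the triangle. -/
noncomputable def saddle (x : EuclideanSpace ℝ (Fin 2)) : ℝ := x 0 ^ 2 - x 1 ^ 2

theorem contDiff_saddle : ContDiff ℝ 1 saddle := by
  unfold saddle
  fun_prop

theorem norm_fderiv_saddle_sq (x : EuclideanSpace ℝ (Fin 2)) :
    ‖fderiv ℝ saddle x‖ ^ 2 = 4 * x 0 ^ 2 + 4 * x 1 ^ 2 := by
  have h : ∀ i : Fin 2, HasFDerivAt (fun y : EuclideanSpace ℝ (Fin 2) => y i)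
      (EuclideanSpace.proj i : EuclideanSpace ℝ (Fin 2) →L[ℝ] ℝ) x := fun i =>
    (EuclideanSpace.proj i : EuclideanSpace ℝ (Fin 2) →L[ℝ] ℝ).hasFDerivAt
  have hd := ((h 0).pow 2).sub ((h 1).pow 2)
  have he : fderiv ℝ saddle x = _ := hd.fderiv
  rw [he, norm_sq_clm_eq]
  simp
  ring

theorem integral_norm_fderiv_saddle_sq {a : ℝ} (ha : 0 < a) :
    ∫ x in openTriangle a, ‖fderiv ℝ saddle x‖ ^ 2 = 2 * a ^ 4 / 3 := by
  set H : ℝ × ℝ → ℝ := fun z =>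
    (openTriangle a).indicator (fun x => ‖fderiv ℝ saddle x‖ ^ 2) (pt2 z.1 z.2) with hH
  have hHeq : ∀ x y, H (x, y) =
      (Ioo 0 a).indicator (fun x =>
        (Ioo 0 (a - x)).indicator (fun y => 4 * x ^ 2 + 4 * y ^ 2) y) x := fun x y => by
    by_cases h : pt2 x y ∈ openTriangle a
    · obtain ⟨h1, h2, h3⟩ := pt2_mem_openTriangle.1 h
      rw [indicator_of_mem (show x ∈ Ioo 0 a from ⟨h1, by linarith⟩),
        indicator_of_mem (show y ∈ Ioo 0 (a - x) from ⟨h2, by linarith⟩)]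
      simp only [hH]
      rw [indicator_of_mem h, norm_fderiv_saddle_sq]
      rfl
    · simp only [hH]
      rw [indicator_of_notMem h]
      by_cases hx : x ∈ Ioo 0 a
      · rw [indicator_of_mem hx, indicator_of_notMem]
        exact fun hy => h (pt2_mem_openTriangle.2 ⟨hx.1, hy.1, by linarith [hy.2]⟩)
      · rw [indicator_of_notMem hx]
  have hHm : Measurable H := (((measurable_fderiv ℝ saddle).norm.pow_const 2).indicator
    (isOpen_openTriangle a).measurableSet).comp continuous_pt2.measurable
  obtain ⟨M, hM0, hM⟩ := exists_norm_fderiv_le ha contDiff_saddle.contDiffOn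
  have hHi : Integrable H := by
    refine integrable_of_abs_le_of_support (M := M ^ 2) (A := a) hHm (fun z => ?_) fun z hz => ?_
    · simp only [hH, indicator]
      split_ifs with h
      · rw [abs_pow, abs_norm]
        exact pow_le_pow_left₀ (norm_nonneg _) (hM _ h) 2
      · simpa using sq_nonneg M
    · obtain ⟨h1, h2, h3⟩ := pt2_mem_openTriangle.1 (mem_of_indicator_ne_zero hz)
      rw [abs_of_pos h1, abs_of_pos h2]
      constructor <;> linarith
  have hinner : ∀ x, ∫ y, H (x, y) =
      (Ioo 0 a).indicator (fun x => 4 * x ^ 2 * (a - x) + 4 * ((a - x) ^ 3 / 3)) x := fun x => by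
    simp_rw [hHeq]
    by_cases hx : x ∈ Ioo 0 a
    · simp_rw [indicator_of_mem hx]
      rw [MeasureTheory.integral_indicator measurableSet_Ioo,
        integral_Ioo_eq_intervalIntegral (by linarith [hx.2]),
        integral_add intervalIntegrable_const (by apply Continuous.intervalIntegrable; fun_prop),
        intervalIntegral.integral_const, intervalIntegral.integral_const_mul, integral_pow,
        smul_eq_mul]
      norm_num
      ring
    · simp [indicator_of_notMem hx]
  rw [setIntegral_openTriangle, Measure.volume_eq_prod, integral_prod _ hHi]
  simp_rw [hinner]
  rw [MeasureTheory.integral_indicator measurableSet_Ioo, integral_Ioo_eq_intervalIntegral ha.le]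
  rw [integral_eq_sub_of_hasDerivAt
    (f := fun x => 4 * a / 3 * x ^ 3 - x ^ 4 - (a - x) ^ 4 / 3)
    (fun x _ => ?_) (by apply Continuous.intervalIntegrable; fun_prop)]
  · ring
  · have := ((((hasDerivAt_pow 3 x).const_mul (4 * a / 3)).sub (hasDerivAt_pow 4 x)).sub
      ((((hasDerivAt_id x).const_sub a).pow 4).div_const 3))
    refine this.congr_deriv ?_
    simp only [id]
    norm_num
    ring

/-- **The sloshing (mixed Steklov) eigenvalue of the right isosceles triangle with the
hypotenuse as free boundary.** For the right triangle `Ω` with vertices `(0,0)`, `(a,0)`,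
`(0,a)` and its hypotenuse `G` parametrized by `t ↦ (t, a-t)` (arclength element
`√2 dt`), every continuously differentiable `u` on the closed triangle satisfies
`√2 ∫₀^a (u(t,a-t) - ⟨u⟩_G)² dt ≤ (a/√2) ∫_Ω |∇u|²`, where
`⟨u⟩_G = (1/a)∫₀^a u(t,a-t) dt`, and `a/√2` is the smallest constant with this
property. -/
theorem steklov_right_triangle_hypotenuse (a : ℝ) (ha : 0 < a) :
    (∀ u : EuclideanSpace ℝ (Fin 2) → ℝ,
        ContDiffOn ℝ 1 u (closedTriangle a) →
        Real.sqrt 2 * ∫ t in (0 : ℝ)..a,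
            (u (pt2 t (a - t)) - (1 / a) * ∫ s in (0 : ℝ)..a, u (pt2 s (a - s))) ^ 2 ≤
          (a / Real.sqrt 2) * ∫ x in openTriangle a, ‖fderiv ℝ u x‖ ^ 2) ∧
    (∀ C : ℝ,
      (∀ u : EuclideanSpace ℝ (Fin 2) → ℝ,
        ContDiffOn ℝ 1 u (closedTriangle a) →
        Real.sqrt 2 * ∫ t in (0 : ℝ)..a,
            (u (pt2 t (a - t)) - (1 / a) * ∫ s in (0 : ℝ)..a, u (pt2 s (a - s))) ^ 2 ≤
          C * ∫ x in openTriangle a, ‖fderiv ℝ u x‖ ^ 2) →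
      a / Real.sqrt 2 ≤ C) := by
  refine ⟨fun u hu => hypotenuse_bound ha hu, fun C hC => ?_⟩
  have h := hC saddle contDiff_saddle.contDiffOn
  have htr : ∀ t, saddle (pt2 t (a - t)) = 2 * a * t - a ^ 2 := fun t => by
    rw [saddle, pt2_apply_zero, pt2_apply_one]; ring
  have hmean : ∫ s in (0 : ℝ)..a, (2 * a * s - a ^ 2) = 0 := by
    rw [integral_sub (by apply Continuous.intervalIntegrable; fun_prop) intervalIntegrable_const,
      intervalIntegral.integral_const_mul, integral_id, intervalIntegral.integral_const, smul_eq_mul]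
    ring
  have hvar : ∫ t in (0 : ℝ)..a, (2 * a * t - a ^ 2) ^ 2 = a ^ 5 / 3 := by
    rw [integral_eq_sub_of_hasDerivAt (f := fun t => (2 * a * t - a ^ 2) ^ 3 / (6 * a))
      (fun t _ => ?_) (by apply Continuous.intervalIntegrable; fun_prop)]
    · field_simp; ring
    · have := ((((hasDerivAt_id t).const_mul (2 * a)).sub_const (a ^ 2)).pow 3).div_const (6 * a)
      refine this.congr_deriv ?_
      simp only [id]
      field_simp
      norm_num
      ring
  simp_rw [htr, hmean, mul_zero, sub_zero, hvar] at h
  rw [integral_norm_fderiv_saddle_sq ha] at h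
  have h2 : √2 * √2 = 2 := Real.mul_self_sqrt (by norm_num)
  have h2p : 0 < √2 := by positivity
  have h3 : √2 * a ≤ 2 * C := by
    refine le_of_mul_le_mul_right ?_ (by positivity : 0 < a ^ 4 / 3)
    linarith
  rw [div_le_iff₀ h2p]
  nlinarith
end
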